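/- arXiv:2206.12499 — 2 statements merged into one kernel-verified Lean document; each statement's English description precedes it below -/
import Mathlib

section
/- Let k ≥ ℓ ≥ 3 and let s^(b)_n(k,ℓ) denote the number of (k,ℓ)-bicrucial permutations of length n. Then for every n with k+2ℓ−5 ≤ n < (k−1)(ℓ−1), we have s^(b)_n(k,ℓ) < s^(b)_{n+1}(k,ℓ). -/
/-- `σ` (in one-line notation, 0-based) has an increasing subsequence of length `k`,
i.e. contains an occurrence of the pattern `i_k`. -/
def HasIncr (k n : ℕ) (σ : Fin n → Fin n) : Prop :=
  ∃ f : Fin k → Fin n, StrictMono f ∧ StrictMono (σ ∘ f)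

/-- `σ` has a decreasing subsequence of length `l`,
i.e. contains an occurrence of the pattern `d_l`. -/
def HasDecr (l n : ℕ) (σ : Fin n → Fin n) : Prop :=
  ∃ f : Fin l → Fin n, StrictMono f ∧ StrictAnti (σ ∘ f)

/-- `σ` contains `i_k` or `d_l`. -/
def ContainsPat (k l n : ℕ) (σ : Fin n → Fin n) : Prop :=
  HasIncr k n σ ∨ HasDecr l n σ

/-- `σ` avoids both `i_k` and `d_l`. -/
def AvoidsPat (k l n : ℕ) (σ : Fin n → Fin n) : Prop :=
  ¬ HasIncr k n σ ∧ ¬ HasDecr l n σ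

/-- The `i`-th extension of `σ` to the right (0-based): append the value `i` at the end,
renaming old values via `Fin.succAbove i` (i.e. `x ↦ x` if `x < i`, `x ↦ x+1` if `x ≥ i`). -/
def rightExt {n : ℕ} (σ : Fin n → Fin n) (i : Fin (n + 1)) : Fin (n + 1) → Fin (n + 1) :=
  Fin.snoc (fun j => i.succAbove (σ j)) i

/-- The `i`-th extension of `σ` to the left: prepend the value `i`. -/
def leftExt {n : ℕ} (σ : Fin n → Fin n) (i : Fin (n + 1)) : Fin (n + 1) → Fin (n + 1) :=
  Fin.cons i (fun j => i.succAbove (σ j))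

/-- The `i`-th extension of `σ` from above: insert the new maximum value at position `i`. -/
def topExt {n : ℕ} (σ : Fin n → Fin n) (i : Fin (n + 1)) : Fin (n + 1) → Fin (n + 1) :=
  i.insertNth (Fin.last n) (fun j => (σ j).castSucc)

/-- The `i`-th extension of `σ` from below: insert the new minimum value at position `i`,
increasing all old values by one. -/
def botExt {n : ℕ} (σ : Fin n → Fin n) (i : Fin (n + 1)) : Fin (n + 1) → Fin (n + 1) :=
  i.insertNth 0 (fun j => (σ j).succ)

/-- `σ` is `(k,l)`-right-crucial (also called `(k,l)`-crucial): it avoids `i_k` and `d_l`,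
but every extension of it to the right contains `i_k` or `d_l`. -/
def RightCrucial (k l n : ℕ) (σ : Fin n → Fin n) : Prop :=
  AvoidsPat k l n σ ∧ ∀ i : Fin (n + 1), ContainsPat k l (n + 1) (rightExt σ i)

/-- `σ` is `(k,l)`-left-crucial. -/
def LeftCrucial (k l n : ℕ) (σ : Fin n → Fin n) : Prop :=
  AvoidsPat k l n σ ∧ ∀ i : Fin (n + 1), ContainsPat k l (n + 1) (leftExt σ i)

/-- `σ` is `(k,l)`-top-crucial. -/
def TopCrucial (k l n : ℕ) (σ : Fin n → Fin n) : Prop :=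
  AvoidsPat k l n σ ∧ ∀ i : Fin (n + 1), ContainsPat k l (n + 1) (topExt σ i)

/-- `σ` is `(k,l)`-bottom-crucial. -/
def BottomCrucial (k l n : ℕ) (σ : Fin n → Fin n) : Prop :=
  AvoidsPat k l n σ ∧ ∀ i : Fin (n + 1), ContainsPat k l (n + 1) (botExt σ i)

/-- `σ` is `(k,l)`-bicrucial: both right-crucial and left-crucial. -/
def Bicrucial (k l n : ℕ) (σ : Fin n → Fin n) : Prop :=
  RightCrucial k l n σ ∧ LeftCrucial k l n σ

/-- `σ` is `(k,l)`-top-right-crucial: right-crucial and every extension from above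
contains `i_k` or `d_l`. -/
def TopRightCrucial (k l n : ℕ) (σ : Fin n → Fin n) : Prop :=
  RightCrucial k l n σ ∧ ∀ i : Fin (n + 1), ContainsPat k l (n + 1) (topExt σ i)

/-- `σ` is `(k,l)`-tricrucial: bicrucial and every extension from above
contains `i_k` or `d_l`. -/
def Tricrucial (k l n : ℕ) (σ : Fin n → Fin n) : Prop :=
  Bicrucial k l n σ ∧ ∀ i : Fin (n + 1), ContainsPat k l (n + 1) (topExt σ i)

/-- `σ` is `(k,l)`-quadrocrucial: tricrucial and every extension from below
contains `i_k` or `d_l`. -/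
def Quadrocrucial (k l n : ℕ) (σ : Fin n → Fin n) : Prop :=
  Tricrucial k l n σ ∧ ∀ i : Fin (n + 1), ContainsPat k l (n + 1) (botExt σ i)

namespace BC

def LInc (k : ℕ) (w : List ℕ) : Prop :=
  ∃ s : List ℕ, s.Sublist w ∧ k ≤ s.length ∧ s.Pairwise (· ≤ ·)

def LDec (k : ℕ) (w : List ℕ) : Prop :=
  ∃ s : List ℕ, s.Sublist w ∧ k ≤ s.length ∧ s.Pairwise (· > ·)

theorem LInc.mono {k : ℕ} {w w' : List ℕ} (h : LInc k w) (hs : w.Sublist w') : LInc k w' := by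
  obtain ⟨s, h1, h2, h3⟩ := h
  exact ⟨s, h1.trans hs, h2, h3⟩

theorem LDec.mono {k : ℕ} {w w' : List ℕ} (h : LDec k w) (hs : w.Sublist w') : LDec k w' := by
  obtain ⟨s, h1, h2, h3⟩ := h
  exact ⟨s, h1.trans hs, h2, h3⟩

theorem LInc.map {k : ℕ} {w : List ℕ} (h : LInc k w) {f : ℕ → ℕ} (hf : StrictMono f) :
    LInc k (w.map f) := by
  obtain ⟨s, h1, h2, h3⟩ := h
  refine ⟨s.map f, h1.map f, by simpa using h2, ?_⟩
  rw [List.pairwise_map]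
  exact h3.imp (fun h => hf.monotone h)

theorem LDec.map {k : ℕ} {w : List ℕ} (h : LDec k w) {f : ℕ → ℕ} (hf : StrictMono f) :
    LDec k (w.map f) := by
  obtain ⟨s, h1, h2, h3⟩ := h
  refine ⟨s.map f, h1.map f, by simpa using h2, ?_⟩
  rw [List.pairwise_map]
  exact h3.imp (fun h => hf h)

/-- Knuth equivalence. -/
inductive Kn : List ℕ → List ℕ → Prop
  | refl (w) : Kn w w
  | symm {w w'} : Kn w w' → Kn w' w
  | trans {a b c} : Kn a b → Kn b c → Kn a c
  | k1 (u v : List ℕ) (x y z : ℕ) : x < y → y ≤ z → Kn (u ++ [y, z, x] ++ v) (u ++ [y, x, z] ++ v)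
  | k2 (u v : List ℕ) (x y z : ℕ) : x ≤ y → y < z → Kn (u ++ [x, z, y] ++ v) (u ++ [z, x, y] ++ v)

theorem Kn.ctx {w w' : List ℕ} (h : Kn w w') (p q : List ℕ) : Kn (p ++ w ++ q) (p ++ w' ++ q) := by
  induction h with
  | refl => exact .refl _
  | symm _ ih => exact ih.symm
  | trans _ _ i1 i2 => exact i1.trans i2
  | k1 u v x y z h1 h2 => simpa using Kn.k1 (p ++ u) (v ++ q) x y z h1 h2
  | k2 u v x y z h1 h2 => simpa using Kn.k2 (p ++ u) (v ++ q) x y z h1 h2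

theorem Kn.appR {w w' : List ℕ} (h : Kn w w') (q : List ℕ) : Kn (w ++ q) (w' ++ q) := by
  simpa using h.ctx [] q

theorem Kn.appL {w w' : List ℕ} (h : Kn w w') (p : List ℕ) : Kn (p ++ w) (p ++ w') := by
  simpa using h.ctx p []

theorem Kn.map {w w' : List ℕ} (h : Kn w w') {f : ℕ → ℕ} (hf : StrictMono f) :
    Kn (w.map f) (w'.map f) := by
  induction h with
  | refl => exact .refl _
  | symm _ ih => exact ih.symm
  | trans _ _ i1 i2 => exact i1.trans i2
  | k1 u v x y z h1 h2 => simpa using Kn.k1 (u.map f) (v.map f) _ _ _ (hf h1) (hf.monotone h2)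
  | k2 u v x y z h1 h2 => simpa using Kn.k2 (u.map f) (v.map f) _ _ _ (hf.monotone h1) (hf h2)

theorem Kn.filt {w w' : List ℕ} (h : Kn w w') (N : ℕ) :
    Kn (w.filter (· < N)) (w'.filter (· < N)) := by
  induction h with
  | refl => exact .refl _
  | symm _ ih => exact ih.symm
  | trans _ _ i1 i2 => exact i1.trans i2
  | k1 u v x y z h1 h2 =>
    by_cases hz : z < N
    · have hy : y < N := by omega
      have hx : x < N := by omega
      simpa [List.filter_append, List.filter_cons, hx, hy, hz] using Kn.k1 (u.filter (· < N)) (v.filter (· < N)) _ _ _ h1 h2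
    · simp only [List.filter_append, List.filter_cons, hz]
      by_cases hy : y < N <;> by_cases hx : x < N <;> simp [hx, hy] <;> exact .refl _
  | k2 u v x y z h1 h2 =>
    by_cases hz : z < N
    · have hy : y < N := by omega
      have hx : x < N := by omega
      simpa [List.filter_append, List.filter_cons, hx, hy, hz] using Kn.k2 (u.filter (· < N)) (v.filter (· < N)) _ _ _ h1 h2
    · simp only [List.filter_append, List.filter_cons, hz]
      by_cases hy : y < N <;> by_cases hx : x < N <;> simp [hx, hy] <;> exact .refl _

theorem Kn.perm {w w' : List ℕ} (h : Kn w w') : w.Perm w' := by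
  induction h with
  | refl => exact .refl _
  | symm _ ih => exact ih.symm
  | trans _ _ i1 i2 => exact i1.trans i2
  | k1 u v x y z h1 h2 =>
    exact ((((List.Perm.swap x z []).cons y).append_left u).append_right v)
  | k2 u v x y z h1 h2 =>
    exact (((List.Perm.swap z x [y]).append_left u).append_right v)

theorem sub3 {s u v : List ℕ} {a b c : ℕ} (h : s.Sublist (u ++ [a, b, c] ++ v)) :
    ∃ p m q, s = p ++ m ++ q ∧ p.Sublist u ∧ q.Sublist v ∧
      (m = [] ∨ m = [a] ∨ m = [b] ∨ m = [c] ∨ m = [a,b] ∨ m = [a,c] ∨ m = [b,c] ∨ m = [a,b,c]) := by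
  rw [List.sublist_append_iff] at h
  obtain ⟨s1, q, rfl, h1, hq⟩ := h
  rw [List.sublist_append_iff] at h1
  obtain ⟨p, m, rfl, hp, hm⟩ := h1
  refine ⟨p, m, q, rfl, hp, hq, ?_⟩
  have : m ∈ [a,b,c].sublists := by simpa using hm
  simp [List.sublists] at this
  tauto

theorem glue {u v p q m m' : List ℕ} (hp : p.Sublist u) (hq : q.Sublist v) (hm : m.Sublist m') :
    (p ++ m ++ q).Sublist (u ++ m' ++ v) := (hp.append hm).append hq

theorem subs3 (a b c : ℕ) : [].Sublist [a,b,c] ∧ [a].Sublist [a,b,c] ∧ [b].Sublist [a,b,c] ∧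
    [c].Sublist [a,b,c] ∧ [a,b].Sublist [a,b,c] ∧ [a,c].Sublist [a,b,c] ∧ [b,c].Sublist [a,b,c] ∧
    [a,b,c].Sublist [a,b,c] := by
  simp [List.sublist_cons_iff]

theorem inc_k1 {k : ℕ} {u v : List ℕ} {x y z : ℕ} (h1 : x < y) (h2 : y ≤ z) :
    LInc k (u ++ [y, z, x] ++ v) ↔ LInc k (u ++ [y, x, z] ++ v) := by
  have S := subs3 y z x
  have S' := subs3 y x z
  constructor
  · rintro ⟨s, hs, hk, hp⟩
    obtain ⟨p, m, q, rfl, hpu, hqv, hm⟩ := sub3 hs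
    rcases hm with rfl | rfl | rfl | rfl | rfl | rfl | rfl | rfl
    case inr.inr.inr.inr.inr.inr.inl => simp [List.pairwise_append] at hp; omega
    case inr.inr.inr.inr.inr.inr.inr => simp [List.pairwise_append] at hp; omega
    all_goals exact ⟨_, glue hpu hqv (by tauto), hk, hp⟩
  · rintro ⟨s, hs, hk, hp⟩
    obtain ⟨p, m, q, rfl, hpu, hqv, hm⟩ := sub3 hs
    rcases hm with rfl | rfl | rfl | rfl | rfl | rfl | rfl | rfl
    case inr.inr.inr.inr.inr.inr.inl =>
      refine ⟨p ++ [y,z] ++ q, glue hpu hqv (by tauto), by simpa using hk, ?_⟩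
      clear S S' hs hk hpu hqv; simp [List.pairwise_append] at hp ⊢; grind
    case inr.inr.inr.inr.inr.inr.inr => simp [List.pairwise_append] at hp; omega
    all_goals exact ⟨_, glue hpu hqv (by tauto), hk, hp⟩

theorem inc_k2 {k : ℕ} {u v : List ℕ} {x y z : ℕ} (h1 : x ≤ y) (h2 : y < z) :
    LInc k (u ++ [x, z, y] ++ v) ↔ LInc k (u ++ [z, x, y] ++ v) := by
  have S := subs3 x z y
  have S' := subs3 z x y
  constructor
  · rintro ⟨s, hs, hk, hp⟩
    obtain ⟨p, m, q, rfl, hpu, hqv, hm⟩ := sub3 hs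
    rcases hm with rfl | rfl | rfl | rfl | rfl | rfl | rfl | rfl
    case inr.inr.inr.inr.inl =>
      refine ⟨p ++ [x,y] ++ q, glue hpu hqv (by tauto), by simpa using hk, ?_⟩
      clear S S' hs hk hpu hqv; simp [List.pairwise_append] at hp ⊢; grind
    case inr.inr.inr.inr.inr.inr.inl => simp [List.pairwise_append] at hp; omega
    case inr.inr.inr.inr.inr.inr.inr => simp [List.pairwise_append] at hp; omega
    all_goals exact ⟨_, glue hpu hqv (by tauto), hk, hp⟩
  · rintro ⟨s, hs, hk, hp⟩
    obtain ⟨p, m, q, rfl, hpu, hqv, hm⟩ := sub3 hs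
    rcases hm with rfl | rfl | rfl | rfl | rfl | rfl | rfl | rfl
    case inr.inr.inr.inr.inl => simp [List.pairwise_append] at hp; omega
    case inr.inr.inr.inr.inr.inr.inr => simp [List.pairwise_append] at hp; omega
    all_goals exact ⟨_, glue hpu hqv (by tauto), hk, hp⟩

theorem dec_k1 {k : ℕ} {u v : List ℕ} {x y z : ℕ} (h1 : x < y) (h2 : y ≤ z) :
    LDec k (u ++ [y, z, x] ++ v) ↔ LDec k (u ++ [y, x, z] ++ v) := by
  have S := subs3 y z x
  have S' := subs3 y x z
  constructor
  · rintro ⟨s, hs, hk, hp⟩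
    obtain ⟨p, m, q, rfl, hpu, hqv, hm⟩ := sub3 hs
    rcases hm with rfl | rfl | rfl | rfl | rfl | rfl | rfl | rfl
    case inr.inr.inr.inr.inr.inr.inl =>
      refine ⟨p ++ [y,x] ++ q, glue hpu hqv (by tauto), by simpa using hk, ?_⟩
      clear S S' hs hk hpu hqv; simp [List.pairwise_append] at hp ⊢; grind
    case inr.inr.inr.inr.inr.inr.inr => simp [List.pairwise_append] at hp; omega
    all_goals exact ⟨_, glue hpu hqv (by tauto), hk, hp⟩
  · rintro ⟨s, hs, hk, hp⟩
    obtain ⟨p, m, q, rfl, hpu, hqv, hm⟩ := sub3 hs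
    rcases hm with rfl | rfl | rfl | rfl | rfl | rfl | rfl | rfl
    case inr.inr.inr.inr.inr.inr.inl => simp [List.pairwise_append] at hp; omega
    case inr.inr.inr.inr.inr.inr.inr => simp [List.pairwise_append] at hp; omega
    all_goals exact ⟨_, glue hpu hqv (by tauto), hk, hp⟩

theorem dec_k2 {k : ℕ} {u v : List ℕ} {x y z : ℕ} (h1 : x ≤ y) (h2 : y < z) :
    LDec k (u ++ [x, z, y] ++ v) ↔ LDec k (u ++ [z, x, y] ++ v) := by
  have S := subs3 x z y
  have S' := subs3 z x y
  constructor
  · rintro ⟨s, hs, hk, hp⟩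
    obtain ⟨p, m, q, rfl, hpu, hqv, hm⟩ := sub3 hs
    rcases hm with rfl | rfl | rfl | rfl | rfl | rfl | rfl | rfl
    case inr.inr.inr.inr.inl => simp [List.pairwise_append] at hp; omega
    case inr.inr.inr.inr.inr.inr.inr => simp [List.pairwise_append] at hp; omega
    all_goals exact ⟨_, glue hpu hqv (by tauto), hk, hp⟩
  · rintro ⟨s, hs, hk, hp⟩
    obtain ⟨p, m, q, rfl, hpu, hqv, hm⟩ := sub3 hs
    rcases hm with rfl | rfl | rfl | rfl | rfl | rfl | rfl | rfl
    case inr.inr.inr.inr.inl =>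
      refine ⟨p ++ [z,y] ++ q, glue hpu hqv (by tauto), by simpa using hk, ?_⟩
      clear S S' hs hk hpu hqv; simp [List.pairwise_append] at hp ⊢; grind
    case inr.inr.inr.inr.inr.inr.inr => simp [List.pairwise_append] at hp; omega
    all_goals exact ⟨_, glue hpu hqv (by tauto), hk, hp⟩

theorem Kn.inc {w w' : List ℕ} (h : Kn w w') (k : ℕ) : LInc k w ↔ LInc k w' := by
  induction h with
  | refl => exact Iff.rfl
  | symm _ ih => exact ih.symm
  | trans _ _ i1 i2 => exact i1.trans i2
  | k1 u v x y z h1 h2 => exact inc_k1 h1 h2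
  | k2 u v x y z h1 h2 => exact inc_k2 h1 h2

theorem Kn.dec {w w' : List ℕ} (h : Kn w w') (k : ℕ) : LDec k w ↔ LDec k w' := by
  induction h with
  | refl => exact Iff.rfl
  | symm _ ih => exact ih.symm
  | trans _ _ i1 i2 => exact i1.trans i2
  | k1 u v x y z h1 h2 => exact dec_k1 h1 h2
  | k2 u v x y z h1 h2 => exact dec_k2 h1 h2

end BC

namespace BC
/-- row insertion -/
def rowIns (x : ℕ) : List ℕ → List ℕ × Option ℕ
  | [] => ([x], none)
  | a :: r => if x < a then (x :: r, some a) else (a :: (rowIns x r).1, (rowIns x r).2)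

def tabIns : ℕ → List (List ℕ) → List (List ℕ) × ℕ
  | x, [] => ([[x]], 0)
  | x, r :: T =>
    match (rowIns x r).2 with
    | none => ((rowIns x r).1 :: T, 0)
    | some y => ((rowIns x r).1 :: (tabIns y T).1, (tabIns y T).2 + 1)

def rsk : List ℕ → List (List ℕ) × List ℕ
  | [] => ([], [])
  | x :: v => ((tabIns x (rsk v).1).1, (tabIns x (rsk v).1).2 :: (rsk v).2)

def colLT : List ℕ → List ℕ → Prop
  | _, [] => True
  | [], _ :: _ => False
  | a :: r, b :: s => a < b ∧ colLT r s

def colLE : List ℕ → List ℕ → Prop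
  | _, [] => True
  | [], _ :: _ => False
  | a :: r, b :: s => a ≤ b ∧ colLE r s

def Tab : List (List ℕ) → Prop
  | [] => True
  | r :: T => r ≠ [] ∧ r.Pairwise (· ≤ ·) ∧ colLT r (T.headD []) ∧ Tab T

def read : List (List ℕ) → List ℕ
  | [] => []
  | r :: T => read T ++ r

def addBox : ℕ → List ℕ → List ℕ
  | 0, [] => [1]
  | 0, a :: s => (a + 1) :: s
  | _ + 1, [] => []
  | j + 1, a :: s => a :: addBox j s

def addMax (N : ℕ) : ℕ → List (List ℕ) → List (List ℕ)
  | 0, [] => [[N]]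
  | 0, a :: s => (a ++ [N]) :: s
  | _ + 1, [] => []
  | j + 1, a :: s => a :: addMax N j s

theorem colLT_nil (r : List ℕ) : colLT r [] := by cases r <;> trivial
theorem colLE_nil (r : List ℕ) : colLE r [] := by cases r <;> trivial

theorem colLT.len {r s : List ℕ} (h : colLT r s) : s.length ≤ r.length := by
  induction r generalizing s with
  | nil => cases s <;> simp_all [colLT]
  | cons a r ih => cases s with
    | nil => simp
    | cons b s => simpa using ih h.2

theorem colLE.len {r s : List ℕ} (h : colLE r s) : s.length ≤ r.length := by
  induction r generalizing s with
  | nil => cases s <;> simp_all [colLE]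
  | cons a r ih => cases s with
    | nil => simp
    | cons b s => simpa using ih h.2

theorem colLT.app {r s : List ℕ} (h : colLT r s) (u : List ℕ) : colLT (r ++ u) s := by
  induction r generalizing s with
  | nil => cases s with
    | nil => exact colLT_nil _
    | cons b s => exact h.elim
  | cons a r ih => cases s with
    | nil => exact colLT_nil _
    | cons b s => exact ⟨h.1, ih h.2⟩

theorem colLT.unapp {r s u : List ℕ} (h : colLT (r ++ u) s) (hl : s.length ≤ r.length) :
    colLT r s := by
  induction r generalizing s with
  | nil => cases s with
    | nil => exact colLT_nil _
    | cons b s => simp at hl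
  | cons a r ih => cases s with
    | nil => exact colLT_nil _
    | cons b s => exact ⟨h.1, ih h.2 (by simpa using hl)⟩

theorem colLT.trans_le {r s t : List ℕ} (h : colLT r s) (h' : colLE s t) : colLT r t := by
  induction r generalizing s t with
  | nil => cases s with
    | nil => cases t with
      | nil => trivial
      | cons _ _ => exact h'.elim
    | cons b s => exact h.elim
  | cons a r ih => cases t with
    | nil => exact colLT_nil _
    | cons c t => cases s with
      | nil => exact h'.elim
      | cons b s => exact ⟨lt_of_lt_of_le h.1 h'.1, ih h.2 h'.2⟩

theorem rowIns_none {x : ℕ} {r : List ℕ} (h : (rowIns x r).2 = none) :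
    (rowIns x r).1 = r ++ [x] ∧ ∀ a ∈ r, a ≤ x := by
  induction r with
  | nil => simp [rowIns]
  | cons a r ih =>
    by_cases hx : x < a
    · simp [rowIns, hx] at h
    · simp [rowIns, hx] at h ⊢
      exact ⟨(ih h).1, by omega, (ih h).2⟩

theorem rowIns_append {x : ℕ} {r : List ℕ} (h : ∀ a ∈ r, a ≤ x) :
    rowIns x r = (r ++ [x], none) := by
  induction r with
  | nil => simp [rowIns]
  | cons a r ih =>
    have := ih (fun b hb => h b (by simp [hb]))
    have := h a (by simp)
    simp [rowIns, *]

theorem rowIns_len {x y : ℕ} {r : List ℕ} (h : (rowIns x r).2 = some y) :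
    (rowIns x r).1.length = r.length := by
  induction r with
  | nil => simp [rowIns] at h
  | cons a r ih =>
    by_cases hx : x < a
    · simp [rowIns, hx]
    · simp [rowIns, hx] at h ⊢
      exact ih h

theorem rowIns_lt {x y : ℕ} {r : List ℕ} (h : (rowIns x r).2 = some y) : x < y ∧ y ∈ r := by
  induction r with
  | nil => simp [rowIns] at h
  | cons a r ih =>
    by_cases hx : x < a
    · simp [rowIns, hx] at h
      subst h; simp [hx]
    · simp [rowIns, hx] at h ⊢
      exact ⟨(ih h).1, .inr (ih h).2⟩

theorem rowIns_mem {x : ℕ} {r : List ℕ} : ∀ a ∈ (rowIns x r).1, a = x ∨ a ∈ r := by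
  induction r with
  | nil => simp [rowIns]
  | cons a r ih =>
    by_cases hx : x < a
    · simp [rowIns, hx]; grind
    · simp [rowIns, hx]; grind

theorem rowIns_mem' {x : ℕ} {r : List ℕ} : x ∈ (rowIns x r).1 := by
  induction r with
  | nil => simp [rowIns]
  | cons a r ih =>
    by_cases hx : x < a
    · simp [rowIns, hx]
    · simp [rowIns, hx, ih]

theorem rowIns_mem'' {x y : ℕ} {r : List ℕ} (h : (rowIns x r).2 = some y) :
    ∀ a ∈ r, a = y ∨ a ∈ (rowIns x r).1 := by
  induction r with
  | nil => simp [rowIns] at h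
  | cons a r ih =>
    by_cases hx : x < a
    · simp [rowIns, hx] at h ⊢; grind
    · simp [rowIns, hx] at h ⊢; grind

theorem rowIns_ne {x : ℕ} {r : List ℕ} : (rowIns x r).1 ≠ [] :=
  List.ne_nil_of_mem rowIns_mem'

theorem rowIns_sorted {x : ℕ} {r : List ℕ} (h : r.Pairwise (· ≤ ·)) :
    (rowIns x r).1.Pairwise (· ≤ ·) := by
  induction r with
  | nil => simp [rowIns]
  | cons a r ih =>
    rw [List.pairwise_cons] at h
    by_cases hx : x < a
    · simp [rowIns, hx]
      exact ⟨fun b hb => by have := h.1 b hb; omega, h.2⟩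
    · simp [rowIns, hx]
      refine ⟨fun b hb => ?_, ih h.2⟩
      rcases rowIns_mem b hb with rfl | h'
      · omega
      · exact h.1 b h'

theorem rowIns_colLT {x y : ℕ} {r s : List ℕ} (h : (rowIns x r).2 = some y) (hc : colLT r s) :
    colLT (rowIns x r).1 s := by
  induction r generalizing s with
  | nil => simp [rowIns] at h
  | cons a r ih =>
    cases s with
    | nil => exact colLT_nil _
    | cons b s =>
      by_cases hx : x < a
      · simp [rowIns, hx]
        exact ⟨hx.trans hc.1, hc.2⟩
      · simp [rowIns, hx] at h ⊢
        exact ⟨hc.1, ih h hc.2⟩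

theorem rowIns_bump {x y : ℕ} {r s : List ℕ} (h : (rowIns x r).2 = some y) (hc : colLT r s) :
    colLT (rowIns x r).1 (rowIns y s).1 := by
  induction r generalizing s with
  | nil => simp [rowIns] at h
  | cons a r ih =>
    by_cases hx : x < a
    · simp [rowIns, hx] at h ⊢
      subst h
      cases s with
      | nil => exact ⟨hx, colLT_nil _⟩
      | cons b s =>
        have := hc.1
        simp [rowIns, this]
        exact ⟨hx, hc.2⟩
    · simp [rowIns, hx] at h ⊢
      have hy := (rowIns_lt h).1
      cases s with
      | nil => exact ⟨by omega, colLT_nil _⟩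
      | cons b s =>
        by_cases hb : y < b
        · simp [rowIns, hb]
          exact ⟨by omega, rowIns_colLT h hc.2⟩
        · simp [rowIns, hb]
          exact ⟨hc.1, ih h hc.2⟩

theorem tabIns_head (x : ℕ) (T : List (List ℕ)) :
    (tabIns x T).1.headD [] = (rowIns x (T.headD [])).1 := by
  cases T with
  | nil => simp [tabIns, rowIns]
  | cons r T =>
    simp only [tabIns]
    split <;> simp

theorem tabIns_tab {x : ℕ} {T : List (List ℕ)} (h : Tab T) : Tab (tabIns x T).1 := by
  induction T generalizing x with
  | nil => simp [tabIns, Tab, colLT]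
  | cons r T ih =>
    obtain ⟨h1, h2, h3, h4⟩ := h
    simp only [tabIns]
    split
    · rename_i hn
      refine ⟨rowIns_ne, rowIns_sorted h2, ?_, h4⟩
      rw [(rowIns_none hn).1]
      exact h3.app _
    · rename_i y hy
      refine ⟨rowIns_ne, rowIns_sorted h2, ?_, ih h4⟩
      rw [tabIns_head]
      exact rowIns_bump hy h3

theorem rsk_tab (v : List ℕ) : Tab (rsk v).1 := by
  induction v with
  | nil => trivial
  | cons x v ih => exact tabIns_tab ih

theorem tabIns_shape (x : ℕ) (T : List (List ℕ)) :
    (tabIns x T).1.map List.length = addBox (tabIns x T).2 (T.map List.length) ∧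
    (tabIns x T).2 ≤ T.length := by
  induction T generalizing x with
  | nil => simp [tabIns, addBox]
  | cons r T ih =>
    simp only [tabIns]
    split
    · rename_i hn
      simp [addBox, (rowIns_none hn).1]
    · rename_i y hy
      simp [addBox, (ih y).1, (ih y).2, rowIns_len hy]

/-- injectivity of row insertion -/
theorem rowIns_inj {x x' : ℕ} {r r' : List ℕ} {y : ℕ} (hr : r.Pairwise (· ≤ ·))
    (hr' : r'.Pairwise (· ≤ ·)) (h : (rowIns x r).2 = some y) (h' : (rowIns x' r').2 = some y)
    (he : (rowIns x r).1 = (rowIns x' r').1) : x = x' ∧ r = r' := by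
  induction r generalizing r' with
  | nil => simp [rowIns] at h
  | cons a r ih =>
    cases r' with
    | nil => simp [rowIns] at h'
    | cons a' r' =>
      rw [List.pairwise_cons] at hr hr'
      by_cases hx : x < a <;> by_cases hx' : x' < a' <;> simp [rowIns, hx, hx'] at h h' he
      · grind
      · exfalso
        have h1 := (rowIns_lt h').1
        have h2 : x' ∈ r := by rw [he.2]; exact rowIns_mem'
        have := hr.1 _ h2
        omega
      · exfalso
        have h1 := (rowIns_lt h).1
        have h2 : x ∈ r' := by rw [← he.2]; exact rowIns_mem'
        have := hr'.1 _ h2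
        omega
      · have := ih hr.2 hr'.2 h h' he.2
        grind

theorem tabIns_inj {x x' : ℕ} {T T' : List (List ℕ)} (hT : Tab T) (hT' : Tab T')
    (h : tabIns x T = tabIns x' T') : x = x' ∧ T = T' := by
  induction T generalizing x x' T' with
  | nil =>
    cases T' with
    | nil => simpa [tabIns] using h
    | cons r' T' =>
      simp only [tabIns] at h
      split at h
      · rename_i hn
        rw [(rowIns_none hn).1] at h
        have := hT'.1
        cases r' <;> simp_all
      · simp at h
  | cons r T ih =>
    cases T' with
    | nil =>
      simp only [tabIns] at h
      split at h
      · rename_i hn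
        rw [(rowIns_none hn).1] at h
        have := hT.1
        cases r <;> simp_all
      · simp at h
    | cons r' T' =>
      simp only [tabIns] at h
      split at h
      · rename_i hn
        split at h
        · rename_i hn'
          rw [(rowIns_none hn).1, (rowIns_none hn').1] at h
          simp only [Prod.mk.injEq, List.cons.injEq] at h
          have := List.append_inj' h.1.1 rfl
          simp_all
        · simp at h
      · rename_i y hy
        split at h
        · simp at h
        · rename_i y' hy'
          simp only [Prod.mk.injEq, List.cons.injEq, Nat.add_right_cancel_iff] at h
          obtain ⟨rfl, rfl⟩ := ih hT.2.2.2 hT'.2.2.2 (Prod.ext h.1.2 h.2)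
          obtain ⟨rfl, rfl⟩ := rowIns_inj hT.2.1 hT'.2.1 hy hy' h.1.1
          simp

theorem rsk_len (v : List ℕ) : (rsk v).2.length = v.length := by
  induction v with
  | nil => rfl
  | cons x v ih => simp [rsk, ih]

theorem rsk_inj {v v' : List ℕ} (h : rsk v = rsk v') : v = v' := by
  induction v generalizing v' with
  | nil =>
    have := rsk_len v'
    rw [← h] at this
    simp [rsk] at this
    exact (List.length_eq_zero_iff.1 this.symm).symm
  | cons x v ih =>
    cases v' with
    | nil => simp [rsk] at h
    | cons x' v' =>
      simp only [rsk, Prod.mk.injEq, List.cons.injEq] at h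
      obtain ⟨rfl, h2⟩ := tabIns_inj (rsk_tab v) (rsk_tab v') (Prod.ext h.1 h.2.1)
      rw [ih (Prod.ext h2 h.2.2)]

/-- reverse row insertion -/
theorem rowDel_big {y : ℕ} {a : ℕ} {r t : List ℕ} (hr : (a :: r).Pairwise (· ≤ ·)) (ha : a < y)
    (ht : ∀ b ∈ t, y < b) (hc : colLT (a :: r) t) :
    ∃ x r0, r0.Pairwise (· ≤ ·) ∧ rowIns x r0 = (a :: r, some y) ∧ colLT r0 t := by
  induction r generalizing a t with
  | nil =>
    refine ⟨a, [y], by simp, by simp [rowIns, ha], ?_⟩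
    cases t with
    | nil => exact colLT_nil _
    | cons b t => exact ⟨ht b (by simp), hc.2⟩
  | cons c r ih =>
    rw [List.pairwise_cons] at hr
    by_cases hcy : c < y
    · have ht' : ∀ b ∈ t.tail, y < b := fun b hb => ht b (List.mem_of_mem_tail hb)
      have hc' : colLT (c :: r) t.tail := by
        cases t with
        | nil => exact colLT_nil _
        | cons b t => exact hc.2
      obtain ⟨x, r0, h1, h2, h3⟩ := ih hr.2 hcy ht' hc'
      have hx : x ∈ c :: r := by
        have := rowIns_mem' (x := x) (r := r0); rwa [h2] at this
      have hax := hr.1 x hx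
      refine ⟨x, a :: r0, ?_, ?_, ?_⟩
      · rw [List.pairwise_cons]
        refine ⟨fun b hb => ?_, h1⟩
        rcases rowIns_mem'' (x := x) (y := y) (r := r0) (by rw [h2]) b hb with rfl | h
        · exact ha.le
        · rw [h2] at h; exact hr.1 b h
      · have : ¬ x < a := by omega
        simp [rowIns, this, h2]
      · cases t with
        | nil => exact colLT_nil _
        | cons b t => exact ⟨hc.1, h3⟩
    · refine ⟨a, y :: c :: r, ?_, by simp [rowIns, ha], ?_⟩
      · rw [List.pairwise_cons]
        refine ⟨fun b hb => ?_, hr.2⟩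
        have := hr.2
        rw [List.pairwise_cons] at this
        rcases List.mem_cons.1 hb with rfl | hb
        · omega
        · have := this.1 b hb
          omega
      · cases t with
        | nil => exact colLT_nil _
        | cons b t => exact ⟨ht b (by simp), hc.2⟩

theorem rowDel {y : ℕ} {r t : List ℕ} (hr : r.Pairwise (· ≤ ·)) (ht : t.Pairwise (· ≤ ·))
    (hc : colLT r (rowIns y t).1) :
    ∃ x r0, r0.Pairwise (· ≤ ·) ∧ rowIns x r0 = (r, some y) ∧ colLT r0 t := by
  induction r generalizing t with
  | nil =>
    have := hc.len
    have h2 := rowIns_ne (x := y) (r := t)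
    simp at this
    contradiction
  | cons a r ih =>
    cases t with
    | nil => exact rowDel_big hr hc.1 (by simp) (colLT_nil _)
    | cons b t =>
      rw [List.pairwise_cons] at ht
      by_cases hy : y < b
      · simp [rowIns, hy] at hc
        refine rowDel_big hr hc.1 ?_ ⟨hc.1.trans hy, hc.2⟩
        intro c hcm
        rcases List.mem_cons.1 hcm with rfl | h
        · exact hy
        · have := ht.1 c h; omega
      · simp [rowIns, hy] at hc
        rw [List.pairwise_cons] at hr
        obtain ⟨x, r0, h1, h2, h3⟩ := ih hr.2 ht.2 hc.2
        have hx : x ∈ r := by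
          have := rowIns_mem' (x := x) (r := r0); rwa [h2] at this
        have hax := hr.1 x hx
        have hab := hc.1
        refine ⟨x, a :: r0, ?_, ?_, ⟨hc.1, h3⟩⟩
        · rw [List.pairwise_cons]
          refine ⟨fun b hb => ?_, h1⟩
          rcases rowIns_mem'' (x := x) (y := y) (r := r0) (by rw [h2]) b hb with rfl | h
          · omega
          · rw [h2] at h; exact hr.1 b h
        · have : ¬ x < a := by omega
          simp [rowIns, this, h2]

theorem Tab.headSorted {T : List (List ℕ)} (h : Tab T) : (T.headD []).Pairwise (· ≤ ·) := by
  cases T with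
  | nil => simp
  | cons r T => exact h.2.1

theorem headLen {T T' : List (List ℕ)} (h : T.map List.length = T'.map List.length) :
    (T.headD []).length = (T'.headD []).length := by
  cases T <;> cases T' <;> simp_all

theorem tabDel {j : ℕ} {T0 T' : List (List ℕ)} (h0 : Tab T0) (hj : j ≤ T0.length) (h' : Tab T')
    (hs : T'.map List.length = addBox j (T0.map List.length)) :
    ∃ x T, Tab T ∧ T.map List.length = T0.map List.length ∧ tabIns x T = (T', j) := by
  induction T0 generalizing j T' with
  | nil =>
    have : j = 0 := by simpa using hj
    subst this
    cases T' with
    | nil => simp [addBox] at hs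
    | cons r T' =>
      simp [addBox] at hs
      obtain ⟨h1, rfl⟩ := hs
      obtain ⟨x, rfl⟩ := List.length_eq_one_iff.1 h1
      exact ⟨x, [], trivial, rfl, rfl⟩
  | cons a T0 ih =>
    cases T' with
    | nil => cases j <;> simp [addBox] at hs
    | cons r T' =>
      obtain ⟨g1, g2, g3, g4⟩ := h'
      obtain ⟨f1, f2, f3, f4⟩ := h0
      cases j with
      | zero =>
        simp [addBox] at hs
        obtain ⟨r0, x, rfl⟩ := List.eq_nil_or_concat r |>.resolve_left g1
        simp at hs
        have hne : r0 ≠ [] := by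
          intro h; subst h; simp at hs; exact f1 (List.length_eq_zero_iff.1 hs.1.symm)
        rw [List.concat_eq_append, List.pairwise_append] at g2
        rw [List.concat_eq_append] at g3
        refine ⟨x, r0 :: T', ⟨hne, g2.1, g3.unapp ?_, g4⟩, by simp [hs], ?_⟩
        · rw [headLen hs.2, hs.1]; exact f3.len
        · have := rowIns_append (x := x) (r := r0) (fun b hb => g2.2.2 b hb x (by simp))
          simp [tabIns, this]
      | succ j =>
        simp [addBox] at hs
        obtain ⟨y, T, k1, k2, k3⟩ := ih f4 (by simpa using hj) g4 hs.2
        have hh := tabIns_head y T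
        rw [k3] at hh
        rw [hh] at g3
        obtain ⟨x, r0, m1, m2, m3⟩ := rowDel g2 k1.headSorted g3
        have hl : r0.length = r.length := by
          have := rowIns_len (x := x) (y := y) (r := r0) (by rw [m2])
          rw [m2] at this; exact this.symm
        refine ⟨x, r0 :: T, ⟨?_, m1, m3, k1⟩, by simp [hl, hs, k2], ?_⟩
        · rintro rfl
          exact g1 (List.length_eq_zero_iff.1 hl.symm)
        · simp [tabIns, m2, k3]

theorem rsk_surj (v : List ℕ) (T' : List (List ℕ)) (h : Tab T')
    (hs : T'.map List.length = (rsk v).1.map List.length) : ∃ v', rsk v' = (T', (rsk v).2) := by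
  induction v generalizing T' with
  | nil =>
    simp [rsk] at hs
    subst hs
    exact ⟨[], rfl⟩
  | cons x v ih =>
    have hi := tabIns_shape x (rsk v).1
    simp only [rsk] at hs
    rw [hi.1] at hs
    obtain ⟨y, T, h1, h2, h3⟩ := tabDel (rsk_tab v) hi.2 h hs
    obtain ⟨v', hv'⟩ := ih T h1 h2
    exact ⟨y :: v', by simp [rsk, hv', h3]⟩

theorem rsk_add (v : List ℕ) (j : ℕ) (T' : List (List ℕ)) (h : Tab T') (hj : j ≤ (rsk v).1.length)
    (hs : T'.map List.length = addBox j ((rsk v).1.map List.length)) :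
    ∃ v', rsk v' = (T', j :: (rsk v).2) := by
  obtain ⟨y, T, h1, h2, h3⟩ := tabDel (rsk_tab v) hj h hs
  obtain ⟨v', hv'⟩ := rsk_surj v T h1 h2
  exact ⟨y :: v', by simp [rsk, hv', h3]⟩

end BC

namespace BC

theorem Kn.row0 {x a : ℕ} {r : List ℕ} (h : (a :: r).Pairwise (· ≤ ·)) (hx : x < a) :
    Kn (a :: (r ++ [x])) (a :: x :: r) := by
  induction r generalizing a with
  | nil => exact .refl _
  | cons c r ih =>
    rw [List.pairwise_cons] at h
    have hac := h.1 c (by simp)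
    have h1 := (ih h.2 (by omega)).appL [a]
    exact Kn.trans h1 (Kn.k1 [] r x a c hx hac)

theorem Kn.row {x y : ℕ} {r : List ℕ} (h : r.Pairwise (· ≤ ·)) (hy : (rowIns x r).2 = some y) :
    Kn (r ++ [x]) (y :: (rowIns x r).1) := by
  induction r with
  | nil => simp [rowIns] at hy
  | cons a r ih =>
    by_cases hx : x < a
    · simp [rowIns, hx] at hy ⊢
      subst hy
      exact Kn.row0 h hx
    · simp [rowIns, hx] at hy ⊢
      rw [List.pairwise_cons] at h
      have h1 := (ih h.2 hy).appL [a]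
      refine Kn.trans h1 ?_
      have hxy := (rowIns_lt hy).1
      cases r with
      | nil => simp [rowIns] at hy
      | cons c r =>
        have hac := h.1 c (by simp)
        by_cases hc : x < c
        · simp [rowIns, hc] at hy ⊢
          subst hy
          exact Kn.k2 [] r a x c (by omega) hc
        · simp [rowIns, hc] at hy ⊢
          exact Kn.k2 [] (rowIns x r).1 a c y hac (by omega)

theorem Kn.tab {x : ℕ} {T : List (List ℕ)} (h : Tab T) :
    Kn (read T ++ [x]) (read (tabIns x T).1) := by
  induction T generalizing x with
  | nil => exact .refl _
  | cons r T ih =>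
    simp only [tabIns]
    split
    · rename_i hn
      simp [read, (rowIns_none hn).1]
      exact .refl _
    · rename_i y hy
      simp only [read]
      have h1 := (Kn.row h.2.1 hy).appL (read T)
      have h2 := (ih (x := y) h.2.2.2).appR (rowIns x r).1
      rw [List.append_assoc]
      refine Kn.trans h1 ?_
      simpa using h2

theorem Kn.rsk (v : List ℕ) : Kn v.reverse (read (rsk v).1) := by
  induction v with
  | nil => exact .refl _
  | cons x v ih =>
    rw [List.reverse_cons]
    exact (ih.appR [x]).trans (Kn.tab (rsk_tab v))

/-! tableau bounds -/

theorem dec_le {T : List (List ℕ)} (h : Tab T) {s : List ℕ} (hs : s.Sublist (read T))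
    (hd : s.Pairwise (· > ·)) : s.length ≤ T.length := by
  induction T generalizing s with
  | nil => simp [read] at hs; simp [hs]
  | cons r T ih =>
    simp only [read] at hs
    rw [List.sublist_append_iff] at hs
    obtain ⟨s1, s2, rfl, h1, h2⟩ := hs
    rw [List.pairwise_append] at hd
    have i1 := ih h.2.2.2 h1 hd.1
    have h3 := h.2.1.sublist h2
    have : s2.length ≤ 1 := by
      rcases s2 with _ | ⟨a, _ | ⟨b, s⟩⟩
      · simp
      · simp
      · simp at h3 hd; omega
    simp; omega

theorem sub_colLE {r s : List ℕ} (h : r.Pairwise (· ≤ ·)) (hs : s.Sublist r) : colLE r s := by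
  induction r generalizing s with
  | nil => simp at hs; subst hs; trivial
  | cons a r ih =>
    cases s with
    | nil => exact colLE_nil _
    | cons b s =>
      have hm : b ∈ a :: r := hs.subset (by simp)
      rw [List.pairwise_cons] at h
      refine ⟨?_, ih h.2 ?_⟩
      · rcases List.mem_cons.1 hm with rfl | hm
        · exact le_rfl
        · exact h.1 b hm
      · have := hs.tail; simpa using this

theorem colLE_app {r s1 s2 : List ℕ} (h : r.Pairwise (· ≤ ·)) (hc : colLT r s1)
    (hs : s2.Sublist r) (hi : (s1 ++ s2).Pairwise (· ≤ ·)) : colLE r (s1 ++ s2) := by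
  induction r generalizing s1 with
  | nil =>
    simp at hs; subst hs
    cases s1 with
    | nil => trivial
    | cons _ _ => exact hc.elim
  | cons a r ih =>
    cases s1 with
    | nil => exact sub_colLE h hs
    | cons b s1 =>
      rw [List.pairwise_cons] at h
      rw [List.cons_append, List.pairwise_cons] at hi
      have hab := hc.1
      refine ⟨hc.1.le, ih h.2 hc.2 ?_ hi.2⟩
      rw [List.sublist_cons_iff] at hs
      rcases hs with hs | ⟨t, rfl, ht⟩
      · exact hs
      · exfalso
        have := hi.1 a (by simp)
        omega

theorem inc_colLE {T : List (List ℕ)} (h : Tab T) {s : List ℕ} (hs : s.Sublist (read T))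
    (hd : s.Pairwise (· ≤ ·)) : colLE (T.headD []) s := by
  induction T generalizing s with
  | nil => simp [read] at hs; subst hs; trivial
  | cons r T ih =>
    simp only [read] at hs
    rw [List.sublist_append_iff] at hs
    obtain ⟨s1, s2, rfl, h1, h2⟩ := hs
    have i1 := ih h.2.2.2 h1 (List.pairwise_append.1 hd).1
    exact colLE_app h.2.1 (h.2.2.1.trans_le i1) h2 hd

theorem tab_linc {T : List (List ℕ)} (h : Tab T) (k : ℕ) :
    LInc k (read T) ↔ k ≤ (T.headD []).length := by
  constructor
  · rintro ⟨s, h1, h2, h3⟩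
    exact h2.trans (inc_colLE h h1 h3).len
  · intro hk
    cases T with
    | nil => exact ⟨[], by simp, by simpa using hk, by simp⟩
    | cons r T => exact ⟨r, List.sublist_append_right _ _, hk, h.2.1⟩

theorem tab_col {T : List (List ℕ)} (h : Tab T) : ∃ s : List ℕ, s.Sublist (read T) ∧ s.length = T.length ∧
    s.Pairwise (· > ·) ∧ ∀ a ∈ s, ∀ b r, T.headD [] = b :: r → b ≤ a := by
  induction T with
  | nil => exact ⟨[], by simp, rfl, by simp, by simp⟩
  | cons r T ih =>
    obtain ⟨s, h1, h2, h3, h4⟩ := ih h.2.2.2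
    obtain ⟨f1, f2, f3, f4⟩ := h
    obtain ⟨b, r, rfl⟩ := List.exists_cons_of_ne_nil f1
    have key : ∀ a ∈ s, b < a := by
      intro a ha
      cases T with
      | nil => simp at h2; simp [h2] at ha
      | cons r' T =>
        obtain ⟨c, r', rfl⟩ := List.exists_cons_of_ne_nil f4.1
        have := h4 a ha c r' rfl
        have := f3.1
        omega
    refine ⟨s ++ [b], h1.append (by simp), by simp [h2], ?_, ?_⟩
    · rw [List.pairwise_append]
      refine ⟨h3, by simp, ?_⟩
      simpa using key
    · intro a ha c r' hc
      simp at hc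
      rw [← hc.1]
      rcases List.mem_append.1 ha with ha | ha
      · exact (key a ha).le
      · simp at ha; omega

theorem tab_ldec {T : List (List ℕ)} (h : Tab T) (k : ℕ) :
    LDec k (read T) ↔ k ≤ T.length := by
  constructor
  · rintro ⟨s, h1, h2, h3⟩
    exact h2.trans (dec_le h h1 h3)
  · intro hk
    obtain ⟨s, h1, h2, h3, _⟩ := tab_col h
    exact ⟨s, h1, by omega, h3⟩

/-! adding a maximum -/

theorem addMax_shape (N j : ℕ) (T : List (List ℕ)) :
    (addMax N j T).map List.length = addBox j (T.map List.length) := by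
  induction T generalizing j with
  | nil => cases j <;> simp [addMax, addBox]
  | cons r T ih => cases j <;> simp [addMax, addBox, ih]

theorem addMax_inj {N j : ℕ} {T T' : List (List ℕ)} (h : Tab T) (h' : Tab T')
    (he : addMax N j T = addMax N j T') : T = T' := by
  induction T generalizing j T' with
  | nil =>
    cases T' with
    | nil => rfl
    | cons r T' =>
      have := h'.1
      cases j <;> simp [addMax] at he
      cases r <;> simp_all
  | cons r T ih =>
    cases T' with
    | nil =>
      have := h.1
      cases j <;> simp [addMax] at he
      cases r <;> simp_all
    | cons r' T' =>
      cases j with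
      | zero => simpa [addMax] using he
      | succ j =>
        simp [addMax] at he
        rw [he.1, ih h.2.2.2 h'.2.2.2 he.2]

theorem addMax_read (N j : ℕ) {T : List (List ℕ)} (hj : j ≤ T.length) :
    ∃ u v, read T = u ++ v ∧ read (addMax N j T) = u ++ N :: v := by
  induction T generalizing j with
  | nil =>
    have : j = 0 := by simpa using hj
    subst this
    exact ⟨[], [], rfl, rfl⟩
  | cons r T ih =>
    cases j with
    | zero => exact ⟨read T ++ r, [], by simp [read], by simp [addMax, read]⟩
    | succ j =>
      obtain ⟨u, v, h1, h2⟩ := ih j (by simpa using hj)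
      exact ⟨u, v ++ r, by simp [read, h1], by simp [addMax, read, h2]⟩

theorem colLT_snoc {r s : List ℕ} {N : ℕ} (h : colLT r s) (hl : s.length < r.length)
    (hN : ∀ a ∈ r, a < N) : colLT r (s ++ [N]) := by
  induction r generalizing s with
  | nil => simp at hl
  | cons a r ih =>
    cases s with
    | nil => exact ⟨hN a (by simp), colLT_nil _⟩
    | cons b s => exact ⟨h.1, ih h.2 (by simpa using hl) (fun c hc => hN c (by simp [hc]))⟩

theorem exists_add {K L N : ℕ} {T : List (List ℕ)} (h : Tab T) (hK : (T.headD []).length ≤ K)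
    (hL : T.length ≤ L) (hn : (read T).length < K * L) (hN : ∀ a ∈ read T, a < N) :
    ∃ j, j ≤ T.length ∧ Tab (addMax N j T) ∧ ((addMax N j T).headD []).length ≤ K ∧
      (addMax N j T).length ≤ L := by
  induction T generalizing L with
  | nil =>
    have : 0 < K := by
      rcases Nat.eq_zero_or_pos K with rfl | h
      · simp at hn
      · exact h
    have : 0 < L := by
      rcases Nat.eq_zero_or_pos L with rfl | h
      · simp at hn
      · exact h
    exact ⟨0, le_rfl, by simp [addMax, Tab, colLT], by simp [addMax]; omega, by simp [addMax]; omega⟩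
  | cons r T ih =>
    obtain ⟨f1, f2, f3, f4⟩ := h
    simp only [read, List.mem_append, List.length_append] at hN hn
    simp at hK hL
    by_cases hr : r.length < K
    · refine ⟨0, by simp, ⟨by simp, ?_, f3.app _, f4⟩, by simp [addMax]; omega, by simp [addMax]; omega⟩
      rw [List.pairwise_append]
      refine ⟨f2, by simp, ?_⟩
      intro a ha b hb
      simp at hb
      have := hN a (.inr ha)
      omega
    · obtain ⟨L, rfl⟩ : ∃ L', L = L' + 1 := ⟨L - 1, by omega⟩
      obtain ⟨j, h1, h2, h3, h4⟩ := ih (L := L) f4 (by have := f3.len; omega) (by omega)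
        (by rw [Nat.mul_succ] at hn; omega) (fun a ha => hN a (.inl ha))
      refine ⟨j + 1, by simpa using h1, ⟨f1, f2, ?_, h2⟩, by simp [addMax]; omega,
        by simpa [addMax] using h4⟩
      have hlen := f3.len
      cases T with
      | nil =>
        have : j = 0 := by simpa using h1
        subst this
        simp [addMax] at h3 ⊢
        exact colLT_snoc (s := []) (colLT_nil _) (by simp; omega) (fun a ha => hN a (.inr ha))
      | cons t T =>
        cases j with
        | zero =>
          simp [addMax] at h3 f3 ⊢
          exact colLT_snoc f3 (by omega) (fun a ha => hN a (.inr ha))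
        | succ j => simpa [addMax] using f3

end BC

namespace BC

def ee (i x : ℕ) : ℕ := if x < i then x else x + 1

theorem ee_mono (i : ℕ) : StrictMono (ee i) := by
  intro a b h; unfold ee; split_ifs <;> omega

def Cont (k l : ℕ) (w : List ℕ) : Prop := LInc k w ∨ LDec l w

theorem Cont.mono {k l : ℕ} {w w' : List ℕ} (h : Cont k l w) (hs : w.Sublist w') : Cont k l w' :=
  h.imp (·.mono hs) (·.mono hs)

theorem Cont.map {k l : ℕ} {w : List ℕ} (h : Cont k l w) {f : ℕ → ℕ} (hf : StrictMono f) :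
    Cont k l (w.map f) := h.imp (·.map hf) (·.map hf)

theorem Kn.cont {w w' : List ℕ} (h : Kn w w') (k l : ℕ) : Cont k l w ↔ Cont k l w' :=
  or_congr (h.inc k) (h.dec l)

def LBic (k l n : ℕ) (w : List ℕ) : Prop :=
  ¬ Cont k l w ∧ (∀ i ≤ n, Cont k l (w.map (ee i) ++ [i])) ∧
    (∀ i ≤ n, Cont k l (i :: w.map (ee i)))

theorem Kn.lbic {w w' : List ℕ} (h : Kn w w') {k l n : ℕ} (hb : LBic k l n w) : LBic k l n w' := by
  refine ⟨fun hc => hb.1 ((h.cont k l).2 hc), fun i hi => ?_, fun i hi => ?_⟩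
  · exact (((h.map (ee_mono i)).appR [i]).cont k l).1 (hb.2.1 i hi)
  · exact (((h.map (ee_mono i)).appL [i]).cont k l).1 (hb.2.2 i hi)

theorem map_ee {w : List ℕ} {n : ℕ} (h : ∀ a ∈ w, a < n) : w.map (ee n) = w := by
  conv_rhs => rw [← List.map_id w]
  exact List.map_congr_left (fun a ha => by simp [ee, h a ha])

theorem LBic.add {k l n : ℕ} {w w' : List ℕ} (hb : LBic k l n w) (hs : w.Sublist w')
    (hc : ¬ Cont k l w') (hn : ∀ a ∈ w, a < n) : LBic k l (n + 1) w' := by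
  refine ⟨hc, fun i hi => ?_, fun i hi => ?_⟩
  · rcases Nat.lt_or_ge n i with h | h
    · have : i = n + 1 := by omega
      subst this
      have h1 := (hb.2.1 n le_rfl).map (ee_mono n)
      rw [map_ee hn, List.map_append, map_ee hn] at h1
      simp [ee] at h1
      refine h1.mono (List.Sublist.append ?_ (List.Sublist.refl _))
      rw [← map_ee (w := w) (n := n + 1) (fun a ha => by have := hn a ha; omega)]
      exact hs.map _
    · exact (hb.2.1 i h).mono ((hs.map _).append (List.Sublist.refl _))
  · rcases Nat.lt_or_ge n i with h | h
    · have : i = n + 1 := by omega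
      subst this
      have h1 := (hb.2.2 n le_rfl).map (ee_mono n)
      rw [map_ee hn, List.map_cons, map_ee hn] at h1
      simp [ee] at h1
      refine h1.mono (List.Sublist.cons_cons _ ?_)
      rw [← map_ee (w := w) (n := n + 1) (fun a ha => by have := hn a ha; omega)]
      exact hs.map _
    · exact (hb.2.2 i h).mono (List.Sublist.cons_cons _ (hs.map _))

/-- the step: `v` and `v'` are reversed words -/
theorem step {k l n : ℕ} (hk : 1 ≤ k) (hl : 1 ≤ l) (hn : n < (k - 1) * (l - 1)) {v : List ℕ}
    (hv : v.reverse.Perm (List.range n)) (hb : LBic k l n v.reverse) :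
    ∃ v' j, v'.reverse.Perm (List.range (n + 1)) ∧ LBic k l (n + 1) v'.reverse ∧
      rsk v' = (addMax n j (rsk v).1, j :: (rsk v).2) ∧
      Kn (v'.reverse.filter (· < n)) v.reverse := by
  have hT := rsk_tab v
  have hK := Kn.rsk v
  have hp : (read (rsk v).1).Perm (List.range n) := hK.symm.perm.trans hv
  have hlen : (read (rsk v).1).length = n := by simpa using hp.length_eq
  have hlt : ∀ a ∈ read (rsk v).1, a < n := fun a ha => by simpa using hp.subset ha
  have hc := hb.1
  rw [hK.cont k l] at hc
  unfold Cont at hc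
  rw [tab_linc hT, tab_ldec hT] at hc
  push Not at hc
  obtain ⟨j, h1, h2, h3, h4⟩ := exists_add (K := k - 1) (L := l - 1) (N := n) hT (by omega) (by omega)
    (by omega) hlt
  obtain ⟨v', hv'⟩ := rsk_add v j _ h2 h1 (addMax_shape _ _ _)
  have hK' := Kn.rsk v'
  rw [hv'] at hK'
  obtain ⟨a, b, e1, e2⟩ := addMax_read n j h1
  simp only at hK'
  have hsub : (read (rsk v).1).Sublist (read (addMax n j (rsk v).1)) := by
    rw [e1, e2]
    exact (List.Sublist.refl _).append (List.sublist_cons_self _ _)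
  refine ⟨v', j, ?_, ?_, hv', ?_⟩
  · refine hK'.perm.trans ?_
    rw [e2, List.range_succ]
    refine List.perm_middle.trans ?_
    rw [← e1]
    refine (List.Perm.cons n hp).trans ?_
    exact (List.perm_append_singleton n _).symm
  · refine hK'.symm.lbic ((hK.lbic hb).add hsub ?_ hlt)
    unfold Cont
    rw [tab_linc h2, tab_ldec h2]
    omega
  · refine (hK'.filt n).trans ?_
    rw [e2, List.filter_append, List.filter_cons]
    simp only [lt_self_iff_false, decide_false]
    simp only [Bool.false_eq_true, if_false]
    rw [← List.filter_append, ← e1, List.filter_eq_self.2 (by simpa using hlt)]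
    exact hK.symm

/-- counting at the level of lists -/
def LS (k l n : ℕ) : Set (List ℕ) := {w | w.Perm (List.range n) ∧ LBic k l n w}

theorem LS_finite (k l n : ℕ) : (LS k l n).Finite := by
  refine Set.Finite.subset (List.finite_toSet (List.range n).permutations) ?_
  intro w hw
  simpa using hw.1

theorem count_lt {k l n : ℕ} (hk : 1 ≤ k) (hl : 1 ≤ l) (hn : n < (k - 1) * (l - 1))
    (hex : ∃ w ∈ LS k l (n + 1), ¬ LBic k l n (w.filter (· < n))) :
    (LS k l n).ncard < (LS k l (n + 1)).ncard := by
  have H : ∀ w : LS k l n, ∃ w' j, w' ∈ LS k l (n + 1) ∧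
      rsk w'.reverse = (addMax n j (rsk w.1.reverse).1, j :: (rsk w.1.reverse).2) ∧
      Kn (w'.filter (· < n)) w.1 := by
    rintro ⟨w, hw⟩
    obtain ⟨v', j, h1, h2, h3, h4⟩ := step hk hl hn (v := w.reverse) (by simpa using hw.1)
      (by simpa using hw.2)
    exact ⟨v'.reverse, j, ⟨h1, h2⟩, by simpa using h3, by simpa using h4⟩
  choose f j hf1 hf2 hf3 using H
  have hinj : Function.Injective f := by
    intro a b hab
    have e : rsk (f a).reverse = rsk (f b).reverse := by rw [hab]
    rw [hf2, hf2] at e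
    simp only [Prod.mk.injEq, List.cons.injEq] at e
    obtain ⟨e1, e2, e3⟩ := e
    rw [e2] at e1
    have e4 := addMax_inj (rsk_tab _) (rsk_tab _) e1
    have := rsk_inj (Prod.ext e4 e3)
    exact Subtype.ext (List.reverse_injective this)
  have hss : Set.range f ⊂ LS k l (n + 1) := by
    refine ⟨?_, ?_⟩
    · rintro _ ⟨a, rfl⟩; exact hf1 a
    · intro hsub
      obtain ⟨w, hw, hnw⟩ := hex
      obtain ⟨a, rfl⟩ := hsub hw
      exact hnw ((hf3 a).symm.lbic a.2.2)
  have h1 := Set.ncard_lt_ncard hss (LS_finite _ _ _)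
  have h2 : (Set.range f).ncard = (LS k l n).ncard := by
    rw [← Set.image_univ, Set.ncard_image_of_injective _ hinj, Set.ncard_univ]
    rfl
  omega

end BC

namespace BC

def IncLe (j : ℕ) (w : List ℕ) : Prop := ∀ s : List ℕ, s.Sublist w → s.Pairwise (· ≤ ·) → s.length ≤ j
def DecLe (j : ℕ) (w : List ℕ) : Prop := ∀ s : List ℕ, s.Sublist w → s.Pairwise (· > ·) → s.length ≤ j

theorem IncLe.app {a b : ℕ} {A B : List ℕ} (hA : IncLe a A) (hB : IncLe b B) : IncLe (a + b) (A ++ B) := by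
  intro s hs hp
  obtain ⟨s1, s2, rfl, h1, h2⟩ := List.sublist_append_iff.1 hs
  rw [List.pairwise_append] at hp
  have := hA s1 h1 hp.1
  have := hB s2 h2 hp.2.1
  simp; omega

theorem DecLe.app {c : ℕ} {A B : List ℕ} (hA : DecLe c A) (hB : DecLe c B)
    (h : ∀ x ∈ A, ∀ y ∈ B, x < y) : DecLe c (A ++ B) := by
  intro s hs hp
  obtain ⟨s1, s2, rfl, h1, h2⟩ := List.sublist_append_iff.1 hs
  rw [List.pairwise_append] at hp
  have := hA s1 h1 hp.1
  have := hB s2 h2 hp.2.1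
  rcases s1 with _ | ⟨x, s1⟩
  · simpa
  rcases s2 with _ | ⟨y, s2⟩
  · simpa
  have e1 := hp.2.2 x (by simp) y (by simp)
  have e2 := h x (h1.subset (by simp)) y (h2.subset (by simp))
  omega

theorem incLe_dec {w : List ℕ} (h : w.Pairwise (· > ·)) : IncLe 1 w := by
  intro s hs hp
  have h' := h.sublist hs
  rcases s with _ | ⟨x, _ | ⟨y, s⟩⟩
  · simp
  · simp
  · simp at hp h'
    omega

theorem decLe_len {w : List ℕ} {c : ℕ} (h : w.length ≤ c) : DecLe c w := by
  intro s hs _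
  exact hs.length_le.trans h

theorem not_cont {k l : ℕ} {w : List ℕ} (hk : 1 ≤ k) (hl : 1 ≤ l) (h1 : IncLe (k-1) w) (h2 : DecLe (l-1) w) :
    ¬ Cont k l w := by
  rintro (⟨s, a, b, c⟩ | ⟨s, a, b, c⟩)
  · have := h1 s a c; omega
  · have := h2 s a c; omega

def dn (b m : ℕ) : List ℕ := (List.range' b m).reverse

theorem dn_pw (b m : ℕ) : (dn b m).Pairwise (· > ·) := by
  unfold dn
  rw [List.pairwise_reverse]
  exact List.pairwise_lt_range'

theorem dn_len (b m : ℕ) : (dn b m).length = m := by simp [dn]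

theorem mem_dn {b m x : ℕ} : x ∈ dn b m ↔ b ≤ x ∧ x < b + m := by simp [dn]

theorem dn_perm (b m : ℕ) : (dn b m).Perm (List.range' b m) := List.reverse_perm _

theorem dn_succ (b m : ℕ) : dn b (m+1) = (b + m) :: dn b m := by
  simp [dn, List.range'_concat]

theorem perm_cat {A B : List ℕ} {b m m' : ℕ} (hA : A.Perm (List.range' b m))
    (hB : B.Perm (List.range' (b+m) m')) : (A ++ B).Perm (List.range' b (m+m')) := by
  have := hA.append hB
  rwa [List.range'_append_1] at this

theorem mid_ex (c : ℕ) (hc : 1 ≤ c) : ∀ (j M b : ℕ), j ≤ M → M ≤ j * c → ∃ w : List ℕ,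
    w.Perm (List.range' b M) ∧ LInc j w ∧ IncLe j w ∧ DecLe c w := by
  intro j
  induction j with
  | zero =>
    intro M b h1 h2
    have : M = 0 := by omega
    subst this
    refine ⟨[], by simp, ⟨[], by simp, by simp, by simp⟩, ?_, ?_⟩
    · intro s hs _; simp_all
    · intro s hs _; simp_all
  | succ j ih =>
    intro M b h1 h2
    obtain ⟨m, hm1, hm2, hm3, hm4⟩ : ∃ m, 1 ≤ m ∧ m ≤ c ∧ j + m ≤ M ∧ M ≤ j * c + m := by
      rw [Nat.add_mul, one_mul] at h2
      have : j ≤ j * c := Nat.le_mul_of_pos_right _ hc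
      by_cases h : j + c ≤ M
      · exact ⟨c, by omega, by omega, by omega, by omega⟩
      · exact ⟨M - j, by omega, by omega, by omega, by omega⟩
    obtain ⟨w, p1, p2, p3, p4⟩ := ih (M - m) (b + m) (by omega) (by omega)
    have hw : ∀ y ∈ w, b + m ≤ y := fun y hy => by
      have := p1.mem_iff.1 hy
      simp at this; omega
    refine ⟨dn b m ++ w, ?_, ?_, ?_, ?_⟩
    · have := perm_cat (dn_perm b m) p1
      rwa [show m + (M - m) = M by omega] at this
    · obtain ⟨s, a1, a2, a3⟩ := p2
      refine ⟨[b] ++ s, List.Sublist.append ?_ a1, by simp; omega, ?_⟩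
      · rw [List.singleton_sublist, mem_dn]; omega
      · simp only [List.singleton_append, List.pairwise_cons]
        exact ⟨fun y hy => by have := hw y (a1.subset hy); omega, a3⟩
    · have := (incLe_dec (dn_pw b m)).app p3
      rwa [add_comm] at this
    · refine (decLe_len (by rw [dn_len]; exact hm2)).app p4 ?_
      intro x hx y hy
      have := hw y hy
      rw [mem_dn] at hx
      omega

theorem map_ee_lt {w : List ℕ} {i : ℕ} : (∀ x ∈ w, x < i) → w.map (ee i) = w := map_ee

theorem hex {k l n : ℕ} (hl : 3 ≤ l) (hkl : l ≤ k) (h1 : k + 2 * l - 5 ≤ n) (h2 : n < (k-1)*(l-1)) :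
    ∃ w ∈ LS k l (n+1), ¬ LBic k l n (w.filter (· < n)) := by
  obtain ⟨c, rfl⟩ : ∃ c, l = c + 1 := ⟨l - 1, by omega⟩
  obtain ⟨j, rfl⟩ : ∃ j, k = j + 3 := ⟨k - 3, by omega⟩
  obtain ⟨M, hM⟩ : ∃ M, n + 1 = c + M + c := ⟨n + 1 - 2 * c, by omega⟩
  have h2' : M ≤ j * c := by
    have : (j + 3 - 1) * (c + 1 - 1) = j * c + 2 * c := by
      rw [show j + 3 - 1 = j + 2 by omega, show c + 1 - 1 = c by omega]; ring
    omega
  obtain ⟨mid, p1, p2, p3, p4⟩ := mid_ex c (by omega) j M c (by omega) h2'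
  have hmid : ∀ y ∈ mid, c ≤ y ∧ y < c + M := fun y hy => by
      have := p1.mem_iff.1 hy
      simp at this; omega
  obtain ⟨s, a1, a2, a3⟩ := p2
  have hs : ∀ y ∈ s, c ≤ y ∧ y < c + M := fun y hy => hmid y (a1.subset hy)
  obtain ⟨d, rfl⟩ : ∃ d, c = d + 1 := ⟨c - 1, by omega⟩
  set c := d + 1 with hcdef
  have hchain : ([c - 1] ++ s ++ [c + M]).Sublist (dn 0 c ++ mid ++ dn (c + M) c) := by
    refine List.Sublist.append (List.Sublist.append ?_ a1) ?_
    · rw [List.singleton_sublist, mem_dn]; omega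
    · rw [List.singleton_sublist, mem_dn]; omega
  have hchp : ([c - 1] ++ s ++ [c + M]).Pairwise (· ≤ ·) := by
    simp only [List.pairwise_append, List.pairwise_singleton, List.mem_append, List.mem_singleton]
    refine ⟨⟨trivial, a3, ?_⟩, trivial, ?_⟩
    · rintro x rfl y hy; have := hs y hy; omega
    · rintro x (rfl | hx) y rfl
      · omega
      · have := hs x hx; omega
  refine ⟨dn 0 c ++ mid ++ dn (c + M) c, ⟨?_, ?_, ?_, ?_⟩, ?_⟩
  · rw [List.range_eq_range', hM]
    have := perm_cat (perm_cat (dn_perm 0 c) (by simpa using p1)) (m' := c) (B := dn (c + M) c)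
      (by simpa using dn_perm (c+M) c)
    exact this
  · apply not_cont (by omega) (by omega)
    · have := ((incLe_dec (dn_pw 0 c)).app p3).app (incLe_dec (dn_pw (c+M) c))
      rwa [show 1 + j + 1 = j + 3 - 1 by omega] at this
    · refine DecLe.app (DecLe.app (decLe_len (by rw [dn_len]; omega)) p4 ?_) (decLe_len (by rw [dn_len]; omega)) ?_
      · intro x hx y hy; have := hmid y hy; rw [mem_dn] at hx; omega
      · intro x hx y hy; rw [mem_dn] at hy; rw [List.mem_append, mem_dn] at hx
        rcases hx with hx | hx
        · omega
        · have := hmid x hx; omega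
  · intro i hi
    by_cases hib : c + M < i
    · left
      refine ⟨([c - 1] ++ s ++ [c + M]).map (ee i) ++ [i], (hchain.map _).append (List.Sublist.refl _), by simp; omega, ?_⟩
      have : ([c - 1] ++ s ++ [c + M]).map (ee i) = [c - 1] ++ s ++ [c + M] := by
        apply map_ee
        intro x hx
        simp only [List.mem_append, List.mem_singleton] at hx
        rcases hx with (rfl | hx) | rfl
        · omega
        · have := hs x hx; omega
        · omega
      rw [this, List.pairwise_append]
      refine ⟨hchp, by simp, ?_⟩
      intro x hx y hy
      simp only [List.mem_append, List.mem_singleton] at hx hy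
      rcases hx with (rfl | hx) | rfl
      · omega
      · have := hs x hx; omega
      · omega
    · right
      refine ⟨(dn (c+M) c).map (ee i) ++ [i], ((List.sublist_append_right _ _).map _).append (List.Sublist.refl _), by simp [dn_len], ?_⟩
      rw [List.pairwise_append, List.pairwise_map]
      refine ⟨(dn_pw _ _).imp (fun h => ee_mono i h), by simp, ?_⟩
      intro x hx y hy
      simp only [List.mem_map, mem_dn, List.mem_singleton] at hx hy
      obtain ⟨a, ha, rfl⟩ := hx
      unfold ee; split_ifs <;> omega
  · intro i hi
    by_cases hib : i ≤ c - 1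
    · left
      refine ⟨i :: ([c - 1] ++ s ++ [c + M]).map (ee i), (hchain.map _).cons_cons _, by simp; omega, ?_⟩
      rw [List.pairwise_cons, List.pairwise_map]
      refine ⟨?_, hchp.imp (fun h => (ee_mono i).monotone h)⟩
      intro y hy
      rw [List.mem_map] at hy
      obtain ⟨a, ha, rfl⟩ := hy
      have : i ≤ a := by
        simp only [List.mem_append, List.mem_singleton] at ha
        rcases ha with (rfl | hx) | rfl
        · omega
        · have := hs a hx; omega
        · omega
      unfold ee; split_ifs <;> omega
    · right
      refine ⟨i :: (dn 0 c).map (ee i), (((List.sublist_append_left _ _).trans (List.sublist_append_left _ _)).map _).cons_cons _, by simp [dn_len], ?_⟩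
      rw [List.pairwise_cons, List.pairwise_map]
      refine ⟨?_, (dn_pw _ _).imp (fun h => ee_mono i h)⟩
      intro x hx
      simp only [List.mem_map, mem_dn] at hx
      obtain ⟨a, ha, rfl⟩ := hx
      unfold ee; split_ifs <;> omega
  · have hf : (dn 0 c ++ mid ++ dn (c + M) c).filter (· < n) = dn 0 c ++ mid ++ dn (c + M) d := by
      rw [hcdef, dn_succ (d + 1 + M) d, ← hcdef, List.filter_append, List.filter_append, List.filter_cons,
        List.filter_eq_self.2, List.filter_eq_self.2, List.filter_eq_self.2, if_neg]
      · simp; omega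
      · intro x hx; rw [mem_dn] at hx; simp; omega
      · intro x hx; have := hmid x hx; simp; omega
      · intro x hx; rw [mem_dn] at hx; simp; omega
    rw [hf]
    intro hb
    refine not_cont (by omega) (by omega) ?_ ?_ (hb.2.1 (c + M) (by omega))
    all_goals
      rw [List.map_append, map_ee (w := dn 0 c ++ mid), List.append_assoc]
    all_goals try
      intro x hx; rw [List.mem_append, mem_dn] at hx
      rcases hx with hx | hx
      · omega
      · have := hmid x hx; omega
    · have hd : ((dn (c + M) d).map (ee (c+M)) ++ [c + M]).Pairwise (· > ·) := by
        rw [List.pairwise_append, List.pairwise_map]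
        refine ⟨(dn_pw _ _).imp (fun h => ee_mono _ h), by simp, ?_⟩
        intro x hx y hy
        simp only [List.mem_map, mem_dn, List.mem_singleton] at hx hy
        obtain ⟨a, ha, rfl⟩ := hx
        unfold ee; split_ifs <;> omega
      have := ((incLe_dec (dn_pw 0 c)).app p3).app (incLe_dec hd)
      rwa [show 1 + j + 1 = j + 3 - 1 by omega] at this
    · refine DecLe.app (DecLe.app (decLe_len (by rw [dn_len]; omega)) p4 ?_) (decLe_len (by simp [dn_len]; omega)) ?_
      · intro x hx y hy; have := hmid y hy; rw [mem_dn] at hx; omega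
      · intro x hx y hy
        have hy' : c + M ≤ y := by
          simp only [List.mem_append, List.mem_map, mem_dn, List.mem_singleton] at hy
          rcases hy with ⟨a, ha, rfl⟩ | rfl
          · unfold ee; split_ifs <;> omega
          · omega
        rw [List.mem_append, mem_dn] at hx
        rcases hx with hx | hx
        · omega
        · have := hmid x hx; omega

end BC

namespace BC

def lst {n : ℕ} (σ : Fin n → Fin n) : List ℕ := List.ofFn (fun i => (σ i : ℕ))

theorem lst_pat {n k : ℕ} (σ : Fin n → Fin n) (r : ℕ → ℕ → Prop) :
    (∃ s : List ℕ, s.Sublist (lst σ) ∧ k ≤ s.length ∧ s.Pairwise r) ↔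
    ∃ f : Fin k → Fin n, StrictMono f ∧ ∀ i j, i < j → r (σ (f i)) (σ (f j)) := by
  constructor
  · rintro ⟨s, h1, h2, h3⟩
    obtain ⟨g, hg⟩ := List.sublist_iff_exists_fin_orderEmbedding_get_eq.1 h1
    have hlen : (lst σ).length = n := by simp [lst]
    refine ⟨fun i => Fin.cast hlen (g (Fin.castLE h2 i)), ?_, ?_⟩
    · intro i j hij
      have : g (Fin.castLE h2 i) < g (Fin.castLE h2 j) := g.strictMono hij
      simpa using this
    · intro i j hij
      have := List.pairwise_iff_get.1 h3 (Fin.castLE h2 i) (Fin.castLE h2 j) hij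
      rw [hg, hg] at this
      simp [lst] at this
      exact this
  · rintro ⟨f, h1, h2⟩
    refine ⟨List.ofFn (fun i => (σ (f i) : ℕ)), ?_, by simp, ?_⟩
    · rw [List.sublist_iff_exists_fin_orderEmbedding_get_eq]
      refine ⟨OrderEmbedding.ofStrictMono (fun i => Fin.cast (by simp [lst]) (f (Fin.cast (by simp) i))) ?_, ?_⟩
      · intro i j hij
        have : f (Fin.cast (by simp) i) < f (Fin.cast (by simp) j) := h1 hij
        simpa using this
      · intro i; simp [lst]; rfl
    · rw [List.pairwise_ofFn]
      exact fun i j h => h2 i j h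

theorem lst_inc {n k : ℕ} (σ : Fin n → Fin n) (hσ : σ.Injective) : HasIncr k n σ ↔ LInc k (lst σ) := by
  unfold LInc
  rw [lst_pat]
  unfold HasIncr
  refine exists_congr fun f => and_congr_right fun hf => ?_
  constructor
  · intro h i j hij; exact (h hij).le
  · intro h i j hij
    have h1 := h i j hij
    have h2 : σ (f i) ≠ σ (f j) := fun e => hij.ne (hf.injective (hσ e))
    exact lt_of_le_of_ne h1 h2

theorem lst_dec {n k : ℕ} (σ : Fin n → Fin n) : HasDecr k n σ ↔ LDec k (lst σ) := by
  unfold LDec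
  rw [lst_pat]
  unfold HasDecr
  refine exists_congr fun f => and_congr_right fun hf => ?_
  constructor
  · intro h i j hij; exact h hij
  · intro h i j hij; exact h i j hij

theorem lst_cont {n k l : ℕ} (σ : Fin n → Fin n) (hσ : σ.Injective) :
    ContainsPat k l n σ ↔ Cont k l (lst σ) := by
  unfold ContainsPat Cont
  rw [lst_inc σ hσ, lst_dec]

theorem val_succAbove {n : ℕ} (i : Fin (n+1)) (x : Fin n) : ((i.succAbove x : Fin (n+1)) : ℕ) = ee i x := by
  unfold ee Fin.succAbove
  simp only [Fin.lt_def, Fin.val_castSucc]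
  split_ifs <;> simp

theorem lst_right {n : ℕ} (σ : Fin n → Fin n) (i : Fin (n+1)) :
    lst (rightExt σ i) = (lst σ).map (ee i) ++ [(i : ℕ)] := by
  unfold lst rightExt
  rw [List.ofFn_succ', List.map_ofFn]
  simp only [Fin.snoc_castSucc, Fin.snoc_last, val_succAbove, List.concat_eq_append]
  rfl

theorem lst_left {n : ℕ} (σ : Fin n → Fin n) (i : Fin (n+1)) :
    lst (leftExt σ i) = (i : ℕ) :: (lst σ).map (ee i) := by
  unfold lst leftExt
  rw [List.ofFn_succ, List.map_ofFn]
  simp only [Fin.cons_succ, Fin.cons_zero, val_succAbove]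
  rfl

theorem lst_inj {n : ℕ} {σ : Fin n → Fin n} : σ.Injective ↔ (lst σ).Nodup := by
  unfold lst
  rw [List.nodup_ofFn]
  exact ⟨fun h => Fin.val_injective.comp h, fun h => Function.Injective.of_comp h⟩

theorem ee_ne (i x : ℕ) : ee i x ≠ i := by unfold ee; split_ifs <;> omega

theorem right_inj {n : ℕ} {σ : Fin n → Fin n} (h : σ.Injective) (i : Fin (n+1)) :
    (rightExt σ i).Injective := by
  rw [lst_inj, lst_right, List.nodup_append]
  refine ⟨(lst_inj.1 h).map (ee_mono _).injective, by simp, ?_⟩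
  intro a ha b hb
  rw [List.mem_map] at ha
  obtain ⟨x, -, rfl⟩ := ha
  simp at hb; subst hb
  exact ee_ne _ _

theorem left_inj {n : ℕ} {σ : Fin n → Fin n} (h : σ.Injective) (i : Fin (n+1)) :
    (leftExt σ i).Injective := by
  rw [lst_inj, lst_left, List.nodup_cons]
  refine ⟨?_, (lst_inj.1 h).map (ee_mono _).injective⟩
  intro ha
  rw [List.mem_map] at ha
  obtain ⟨x, -, hx⟩ := ha
  exact ee_ne _ _ hx

theorem lst_bic {n k l : ℕ} {σ : Fin n → Fin n} (h : σ.Injective) :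
    Bicrucial k l n σ ↔ LBic k l n (lst σ) := by
  have hav : AvoidsPat k l n σ ↔ ¬ Cont k l (lst σ) := by
    rw [← lst_cont σ h]; unfold AvoidsPat ContainsPat; tauto
  unfold Bicrucial RightCrucial LeftCrucial LBic
  rw [hav]
  have hr : (∀ i : Fin (n + 1), ContainsPat k l (n + 1) (rightExt σ i)) ↔
      ∀ i ≤ n, Cont k l ((lst σ).map (ee i) ++ [i]) := by
    constructor
    · intro H i hi
      have := (lst_cont _ (right_inj h _)).1 (H ⟨i, by omega⟩)
      rwa [lst_right] at this
    · intro H i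
      rw [lst_cont _ (right_inj h _), lst_right]
      exact H i (by omega)
  have hl : (∀ i : Fin (n + 1), ContainsPat k l (n + 1) (leftExt σ i)) ↔
      ∀ i ≤ n, Cont k l (i :: (lst σ).map (ee i)) := by
    constructor
    · intro H i hi
      have := (lst_cont _ (left_inj h _)).1 (H ⟨i, by omega⟩)
      rwa [lst_left] at this
    · intro H i
      rw [lst_cont _ (left_inj h _), lst_left]
      exact H i (by omega)
  rw [hr, hl]
  tauto

theorem lst_perm {n : ℕ} (σ : Equiv.Perm (Fin n)) : (lst σ).Perm (List.range n) := by
  rw [List.perm_ext_iff_of_nodup (lst_inj.1 σ.injective) List.nodup_range]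
  intro a
  simp only [lst, List.mem_ofFn, List.mem_range, Set.mem_range]
  constructor
  · rintro ⟨i, rfl⟩; exact (σ i).2
  · intro ha; exact ⟨σ.symm ⟨a, ha⟩, by simp⟩

theorem card_eq (k l n : ℕ) :
    Nat.card {σ : Equiv.Perm (Fin n) // Bicrucial k l n ⇑σ} = (LS k l n).ncard := by
  rw [← Nat.card_coe_set_eq]
  refine Nat.card_congr (Equiv.ofBijective
    (fun σ => (⟨lst σ.1, lst_perm σ.1, (lst_bic σ.1.injective).1 σ.2⟩ : LS k l n)) ⟨?_, ?_⟩)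
  · rintro ⟨σ, hσ⟩ ⟨τ, hτ⟩ h
    have h' : lst σ = lst τ := congrArg Subtype.val h
    have := List.ofFn_injective h'
    apply Subtype.ext
    ext i
    exact congrFun this i
  · rintro ⟨w, hw1, hw2⟩
    have hlen : w.length = n := by simpa using hw1.length_eq
    have hlt : ∀ x ∈ w, x < n := fun x hx => by simpa using hw1.mem_iff.1 hx
    let f : Fin n → Fin n := fun i => ⟨w.get (Fin.cast hlen.symm i), hlt _ (List.get_mem _ _)⟩
    have hf : lst f = w := by
      apply List.ext_get
      · simp [lst, hlen]
      · intro m h1 h2; simp [lst, f]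
    have hinj : f.Injective := by
      rw [lst_inj, hf]; exact hw1.nodup_iff.2 List.nodup_range
    have hbij := Finite.injective_iff_bijective.1 hinj
    refine ⟨⟨Equiv.ofBijective f hbij, ?_⟩, ?_⟩
    · rw [lst_bic (Equiv.injective _)]
      simp only [Equiv.coe_ofBijective, hf]; exact hw2
    · simp [hf]

end BC

/-- monotonicity for bicrucial permutations: for `k ≥ l ≥ 3` and
`k+2l-5 ≤ n < (k-1)(l-1)`, the number of `(k,l)`-bicrucial permutations of length `n` is
strictly smaller than the number of those of length `n+1`. -/
theorem bicrucial_count_strict_mono (k l : ℕ) (hl : 3 ≤ l) (hkl : l ≤ k)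
    (n : ℕ) (h1 : k + 2 * l - 5 ≤ n) (h2 : n < (k - 1) * (l - 1)) :
    Nat.card {σ : Equiv.Perm (Fin n) // Bicrucial k l n ⇑σ} <
      Nat.card {σ : Equiv.Perm (Fin (n + 1)) // Bicrucial k l (n + 1) ⇑σ} := by
  rw [BC.card_eq, BC.card_eq]
  exact BC.count_lt (by omega) (by omega) h2 (BC.hex hl hkl h1 h2)
end

section
/- Let k ≥ 3 and let s^(tr)_n(k,3) denote the number of (k,3)-top-right-crucial permutations of length n. Then for every n with k+1 ≤ n ≤ 2(k−1), s^(tr)_n(k,3) = (((2k−n)/(n−k)) · C(n−1, k))², where C(a,b) denotes a binomial coefficient. -/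
lemma hasIncr_iff (k n : ℕ) (σ : Fin n → Fin n) :
    HasIncr k n σ ↔ ∃ s : Finset (Fin n), s.card = k ∧ StrictMonoOn σ s := by
  constructor
  · rintro ⟨f, hf, hg⟩
    refine ⟨Finset.univ.image f, ?_, ?_⟩
    · rw [Finset.card_image_of_injective _ hf.injective]; simp
    · intro a ha b hb hab
      simp at ha hb
      obtain ⟨a, rfl⟩ := ha
      obtain ⟨b, rfl⟩ := hb
      exact hg (hf.lt_iff_lt.1 hab)
  · rintro ⟨s, hs, hm⟩
    refine ⟨s.orderEmbOfFin hs, (s.orderEmbOfFin hs).strictMono, ?_⟩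
    intro a b hab
    exact hm (by simp) (by simp) ((s.orderEmbOfFin hs).strictMono hab)

lemma hasDecr_iff (n : ℕ) (σ : Fin n → Fin n) :
    HasDecr 3 n σ ↔ ∃ a b c : Fin n, a < b ∧ b < c ∧ σ c < σ b ∧ σ b < σ a := by
  constructor
  · rintro ⟨f, hf, hg⟩
    exact ⟨f 0, f 1, f 2, hf (by decide), hf (by decide), hg (by decide), hg (by decide)⟩
  · rintro ⟨a, b, c, h1, h2, h3, h4⟩
    refine ⟨![a, b, c], ?_, ?_⟩
    · rw [Fin.strictMono_iff_lt_succ]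
      intro i; fin_cases i
      · exact h1
      · exact h2
    · rw [Fin.strictAnti_iff_succ_lt]
      intro i; fin_cases i
      · exact h4
      · exact h3

lemma hasIncr_inv {k n : ℕ} {σ τ : Fin n → Fin n} (_h1 : ∀ x, σ (τ x) = x) (h2 : ∀ x, τ (σ x) = x)
    (h : HasIncr k n σ) : HasIncr k n τ := by
  obtain ⟨f, hf, hg⟩ := h
  refine ⟨σ ∘ f, hg, ?_⟩
  intro a b hab
  simp [h2]; exact hf hab

lemma hasDecr_inv {n : ℕ} {σ τ : Fin n → Fin n} (_h1 : ∀ x, σ (τ x) = x) (h2 : ∀ x, τ (σ x) = x)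
    (h : HasDecr 3 n σ) : HasDecr 3 n τ := by
  rw [hasDecr_iff] at h ⊢
  obtain ⟨a, b, c, q1, q2, q3, q4⟩ := h
  exact ⟨σ c, σ b, σ a, q3, q4, by simpa [h2], by simpa [h2]⟩

lemma rightExt_last {n : ℕ} (σ : Fin n → Fin n) (i : Fin (n+1)) :
    rightExt σ i (Fin.last n) = i := by simp [rightExt]

lemma rightExt_cs {n : ℕ} (σ : Fin n → Fin n) (i : Fin (n+1)) (j : Fin n) :
    rightExt σ i j.castSucc = i.succAbove (σ j) := by simp [rightExt]

lemma topExt_self {n : ℕ} (σ : Fin n → Fin n) (i : Fin (n+1)) :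
    topExt σ i i = Fin.last n := by simp [topExt]

lemma topExt_sa {n : ℕ} (σ : Fin n → Fin n) (i : Fin (n+1)) (j : Fin n) :
    topExt σ i (i.succAbove j) = (σ j).castSucc := by simp [topExt]

lemma top_right_inv {n : ℕ} (σ : Equiv.Perm (Fin n)) (i : Fin (n+1)) (x : Fin (n+1)) :
    topExt σ i (rightExt σ.symm i x) = x := by
  induction x using Fin.lastCases with
  | last => rw [rightExt_last, topExt_self]
  | cast x => rw [rightExt_cs, topExt_sa]; simp

lemma right_top_inv {n : ℕ} (σ : Equiv.Perm (Fin n)) (i : Fin (n+1)) (x : Fin (n+1)) :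
    rightExt σ.symm i (topExt σ i x) = x := by
  induction x using Fin.succAboveCases i with
  | x => rw [topExt_self, rightExt_last]
  | p x => rw [topExt_sa, rightExt_cs]; simp

lemma contains_top {k n : ℕ} (σ : Equiv.Perm (Fin n)) (i : Fin (n+1)) :
    ContainsPat k 3 (n+1) (topExt σ i) ↔ ContainsPat k 3 (n+1) (rightExt σ.symm i) := by
  have h1 := top_right_inv σ i
  have h2 := right_top_inv σ i
  constructor
  · rintro (h | h)
    · exact Or.inl (hasIncr_inv h1 h2 h)
    · exact Or.inr (hasDecr_inv h1 h2 h)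
  · rintro (h | h)
    · exact Or.inl (hasIncr_inv h2 h1 h)
    · exact Or.inr (hasDecr_inv h2 h1 h)

lemma cs_lt_of_sa {n : ℕ} (i : Fin (n+1)) (v : Fin n) (h : i.succAbove v < i) :
    v.val < i.val := by
  rw [Fin.succAbove_lt_iff_castSucc_lt] at h
  exact h

lemma right_iff {k n : ℕ} (hk : 1 ≤ k) (hn : 1 ≤ n) (σ : Equiv.Perm (Fin n))
    (hi : ¬ HasIncr k n σ) (hd : ¬ HasDecr 3 n σ) :
    (∀ i, ContainsPat k 3 (n+1) (rightExt σ i)) ↔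
      ∃ s : Finset (Fin n), s.card = k - 1 ∧ StrictMonoOn σ s ∧ ∀ p ∈ s, (σ p).val < n - 1 := by
  constructor
  · intro h
    have h0 := h ⟨n-1, by omega⟩
    set i : Fin (n+1) := ⟨n-1, by omega⟩ with hidef
    have mono : ∀ a b : Fin n, rightExt σ i a.castSucc < rightExt σ i b.castSucc ↔ σ a < σ b := by
      intro a b
      rw [rightExt_cs, rightExt_cs, Fin.succAbove_lt_succAbove_iff]
    rcases h0 with h0 | h0
    · rw [hasIncr_iff] at h0
      obtain ⟨s, hs, hm⟩ := h0
      set t : Finset (Fin n) := Finset.univ.filter (fun p => p.castSucc ∈ s) with ht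
      have htm : StrictMonoOn σ t := by
        intro a ha b hb hab
        simp [ht] at ha hb
        exact (mono a b).1 (hm ha hb (by simpa using hab))
      have himg : t.image Fin.castSucc = s.erase (Fin.last n) := by
        ext x
        induction x using Fin.lastCases with
        | last => simp [Fin.castSucc_ne_last]
        | cast x => simp [ht, Fin.castSucc_ne_last]
      have hcard : t.card = (s.erase (Fin.last n)).card := by
        rw [← himg, Finset.card_image_of_injective _ (Fin.castSucc_injective n)]
      by_cases hl : Fin.last n ∈ s
      · refine ⟨t, ?_, htm, ?_⟩
        · rw [hcard, Finset.card_erase_of_mem hl, hs]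
        · intro p hp
          simp [ht] at hp
          have := hm hp hl (Fin.castSucc_lt_last p)
          rw [rightExt_cs, rightExt_last] at this
          exact cs_lt_of_sa _ _ this
      · exfalso; apply hi
        rw [hasIncr_iff]
        exact ⟨t, by rw [hcard, Finset.erase_eq_of_notMem hl, hs], htm⟩
    · exfalso
      rw [hasDecr_iff] at h0
      obtain ⟨a, b, c, q1, q2, q3, q4⟩ := h0
      obtain ⟨b, rfl⟩ : ∃ b', b = Fin.castSucc b' := ⟨b.castPred (ne_of_lt (lt_of_lt_of_le q2 (Fin.le_last _))), by simp⟩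
      obtain ⟨a, rfl⟩ : ∃ b', a = Fin.castSucc b' := ⟨a.castPred (ne_of_lt (lt_of_lt_of_le q1 (Fin.le_last _))), by simp⟩
      rw [mono] at q4
      induction c using Fin.lastCases with
      | last =>
        rw [rightExt_cs, rightExt_last, Fin.lt_succAbove_iff_le_castSucc] at q3
        have h1 : n - 1 ≤ (σ b).val := q3
        have h2 : (σ b).val < (σ a).val := q4
        have := (σ a).isLt
        omega
      | cast c =>
        rw [mono] at q3
        exact hd ((hasDecr_iff _ _).2 ⟨a, b, c, by simpa using q1, by simpa using q2, q3, q4⟩)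
  · rintro ⟨s, hs, hm, hv⟩ i
    have build : (∀ p ∈ s, (σ p).val < i.val) → HasIncr k (n+1) (rightExt σ i) := by
      intro h
      rw [hasIncr_iff]
      refine ⟨insert (Fin.last n) (s.image Fin.castSucc), ?_, ?_⟩
      · rw [Finset.card_insert_of_notMem (by simp [Fin.castSucc_ne_last]),
          Finset.card_image_of_injective _ (Fin.castSucc_injective n), hs]; omega
      · intro a ha b hb hab
        simp at ha hb
        rcases ha with rfl | ⟨a, ha, rfl⟩
        · exact absurd hab (not_lt_of_ge (Fin.le_last _))
        · rcases hb with rfl | ⟨b, hb, rfl⟩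
          · rw [rightExt_cs, rightExt_last, Fin.succAbove_lt_iff_castSucc_lt]
            exact h a ha
          · rw [rightExt_cs, rightExt_cs, Fin.succAbove_lt_succAbove_iff]
            exact hm ha hb (by simpa using hab)
    by_cases hall : ∀ p ∈ s, (σ p).val < i.val
    · exact Or.inl (build hall)
    · right
      push Not at hall
      obtain ⟨p, hp, hpi⟩ := hall
      by_contra hnd
      have nodesc : ∀ a b : Fin n, a < b → i.val ≤ (σ b).val → σ a < σ b := by
        intro a b hab hb
        by_contra hlt
        have hlt' : σ b < σ a := lt_of_le_of_ne (not_lt.1 hlt) (fun e => by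
          have := σ.injective e; omega)
        apply hnd
        rw [hasDecr_iff]
        refine ⟨a.castSucc, b.castSucc, Fin.last n, by simpa using hab, Fin.castSucc_lt_last _, ?_, ?_⟩
        · rw [rightExt_cs, rightExt_last, Fin.lt_succAbove_iff_le_castSucc]
          exact hb
        · rw [rightExt_cs, rightExt_cs, Fin.succAbove_lt_succAbove_iff]
          exact hlt'
      set q : Fin n := σ.symm ⟨n-1, by omega⟩ with hq
      have hqv : (σ q).val = n - 1 := by simp [hq]
      have before : ∀ a : Fin n, i.val ≤ (σ a).val → (σ a).val < n - 1 → a < q := by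
        intro a h1 h2
        by_contra hlt
        rcases (not_lt.1 hlt).eq_or_lt with e | e
        · rw [e] at hqv; omega
        · have := nodesc q a e h1
          have : (σ q).val < (σ a).val := this
          omega
      have hpq : p < q := before p hpi (hv p hp)
      have hsq : ∀ a ∈ s, a < q := by
        intro a ha
        by_cases h : i.val ≤ (σ a).val
        · exact before a h (hv a ha)
        · refine lt_trans ?_ hpq
          by_contra hpa
          rcases (not_lt.1 hpa).eq_or_lt with e | e
          · subst e; exact h hpi
          · have : (σ p).val < (σ a).val := hm hp ha e
            omega
      apply hi
      rw [hasIncr_iff]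
      refine ⟨insert q s, ?_, ?_⟩
      · rw [Finset.card_insert_of_notMem (fun h => lt_irrefl _ (hsq q h)), hs]; omega
      · intro a ha b hb hab
        simp at ha hb
        rcases ha with rfl | ha
        · rcases hb with rfl | hb
          · exact absurd hab (lt_irrefl _)
          · exact absurd hab (not_lt_of_gt (hsq b hb))
        · rcases hb with rfl | hb
          · show (σ a).val < (σ q).val
            rw [hqv]; exact hv a ha
          · exact hm ha hb hab

lemma trc_iff {k n : ℕ} (hk : 1 ≤ k) (hn : 1 ≤ n) (σ : Equiv.Perm (Fin n)) :
    TopRightCrucial k 3 n σ ↔ ¬ HasIncr k n σ ∧ ¬ HasDecr 3 n σ ∧ 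
      (∃ s : Finset (Fin n), s.card = k - 1 ∧ StrictMonoOn σ s ∧ ∀ p ∈ s, (σ p).val < n - 1) ∧
      (∃ s : Finset (Fin n), s.card = k - 1 ∧ StrictMonoOn σ s ∧ ∀ p ∈ s, p.val < n - 1) := by
  have e1 : ∀ x, σ (σ.symm x) = x := by simp
  have e2 : ∀ x, σ.symm (σ x) = x := by simp
  unfold TopRightCrucial RightCrucial AvoidsPat
  rw [and_assoc, and_assoc]
  refine and_congr_right fun hi => and_congr_right fun hd => ?_
  rw [right_iff hk hn σ hi hd]
  refine and_congr_right fun _ => ?_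
  simp only [contains_top]
  rw [right_iff hk hn σ.symm (fun h => hi (hasIncr_inv e2 e1 h)) (fun h => hd (hasDecr_inv e2 e1 h))]
  constructor
  · rintro ⟨s, hs, hm, hv⟩
    refine ⟨s.image σ.symm, ?_, ?_, ?_⟩
    · rw [Finset.card_image_of_injective _ σ.symm.injective, hs]
    · intro a ha b hb hab
      simp only [Finset.coe_image, Set.mem_image, Finset.mem_coe] at ha hb
      obtain ⟨a, ha, rfl⟩ := ha
      obtain ⟨b, hb, rfl⟩ := hb
      simpa using (hm.lt_iff_lt ha hb).1 hab
    · intro p hp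
      simp only [Finset.mem_image] at hp
      obtain ⟨a, ha, rfl⟩ := hp
      exact hv a ha
  · rintro ⟨s, hs, hm, hv⟩
    refine ⟨s.image σ, ?_, ?_, ?_⟩
    · rw [Finset.card_image_of_injective _ σ.injective, hs]
    · intro a ha b hb hab
      simp only [Finset.coe_image, Set.mem_image, Finset.mem_coe] at ha hb
      obtain ⟨a, ha, rfl⟩ := ha
      obtain ⟨b, hb, rfl⟩ := hb
      simpa using (hm.lt_iff_lt ha hb).1 hab
    · intro p hp
      simp only [Finset.mem_image] at hp
      obtain ⟨a, ha, rfl⟩ := hp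
      simpa using hv a ha

def cnt (B : Finset ℕ) (j : ℕ) : ℕ := (B.filter (· < j)).card

inductive RS : List ℕ → Finset ℕ → Finset ℕ → Prop
  | nil : RS [] ∅ ∅
  | app (x : ℕ) (w : List ℕ) (B C : Finset ℕ) : x ∈ B → x ∉ C → (∀ b ∈ B, b ≤ x) →
      RS w (B.erase x) C → RS (x :: w) B C
  | bump (x y : ℕ) (w : List ℕ) (B C : Finset ℕ) : x ∈ B → x ∉ C → y ∈ C → y ∉ B → x < y →
      (∀ c ∈ C, c ≤ y) → (∀ b ∈ B, b < y → b ≤ x) →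
      RS w (insert y (B.erase x)) (C.erase y) → RS (x :: w) B C

def gg : ℕ → ℕ → ℕ
  | _, 0 => 1
  | 0, _ + 1 => 0
  | a + 1, b + 1 => if a < b then 0 else gg a (b + 1) + gg (a + 1) b

lemma gg_zero (a : ℕ) : gg a 0 = 1 := by cases a <;> simp [gg]

lemma gg_lt (a b : ℕ) (h : a < b) : gg a b = 0 := by
  cases b with
  | zero => omega
  | succ b => cases a with
    | zero => simp [gg]
    | succ a => simp [gg]; omega

lemma gg_succ (a b : ℕ) (h : b ≤ a) : gg (a+1) (b+1) = gg a (b + 1) + gg (a + 1) b := by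
  simp [gg]; omega

lemma gg_choose (N : ℕ) : ∀ a b, a + b = N → b ≤ a →
    gg a (b+1) + Nat.choose (a+b+1) b = Nat.choose (a+b+1) (b+1) := by
  induction N with
  | zero =>
    intro a b h _
    obtain rfl : a = 0 := by omega
    obtain rfl : b = 0 := by omega
    simp [gg]
  | succ N ih =>
    intro a b h hb
    rcases hb.eq_or_lt with rfl | hb
    · rw [gg_lt _ _ (by omega), zero_add]
      exact Nat.choose_symm_of_eq_add (by omega)
    · obtain ⟨a, rfl⟩ : ∃ a', a = a' + 1 := ⟨a - 1, by omega⟩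
      rw [gg_succ _ _ (by omega)]
      have h1 := ih a b (by omega) (by omega)
      cases b with
      | zero =>
        rw [gg_zero]; simp at h1 ⊢; omega
      | succ b =>
        have h2 := ih (a+1) b (by omega) (by omega)
        rw [show a + 1 + b + 1 = a + (b+1) + 1 by ring] at h2
        rw [show a + 1 + (b + 1) + 1 = (a + (b+1) + 1) + 1 by ring,
          Nat.choose_succ_succ, Nat.choose_succ_succ _ (b+1)]
        simp only [Nat.succ_eq_add_one] at *
        omega

lemma gg_final (k n : ℕ) (h1 : k + 1 ≤ n) (h2 : n ≤ 2 * (k - 1)) :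
    gg (k-1) (n-k) * (n-k) = (2 * k - n) * Nat.choose (n - 1) k := by
  obtain ⟨b, rfl⟩ : ∃ b, n = k + (b + 1) := ⟨n - k - 1, by omega⟩
  obtain ⟨a, rfl⟩ : ∃ a, k = a + 1 := ⟨k - 1, by omega⟩
  have h := gg_choose _ a b rfl (by omega)
  have e := Nat.choose_succ_right_eq (a+b+1) b
  have s : Nat.choose (a+b+1) (a+1) = Nat.choose (a+b+1) b :=
    Nat.choose_symm_of_eq_add (by omega)
  rw [show a + 1 - 1 = a by omega, show a + 1 + (b+1) - (a+1) = b + 1 by omega,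
    show a + 1 + (b+1) - 1 = a + b + 1 by omega, s]
  rw [show a + b + 1 - b = a + 1 by omega, ← h] at e
  obtain ⟨d, rfl⟩ : ∃ d, a = b + d := ⟨a - b, by omega⟩
  rw [show 2 * (b + d + 1) - (b + d + 1 + (b + 1)) = d by omega]
  nlinarith

lemma cnt_mono (B : Finset ℕ) {i j : ℕ} (h : i ≤ j) : cnt B i ≤ cnt B j :=
  Finset.card_le_card (fun x hx => by
    simp at hx ⊢; exact ⟨hx.1, by omega⟩)

lemma cnt_insert (B : Finset ℕ) (x j : ℕ) (h : x ∉ B) :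
    cnt (insert x B) j = cnt B j + if x < j then 1 else 0 := by
  unfold cnt
  rw [Finset.filter_insert]
  split_ifs with hx
  · rw [Finset.card_insert_of_notMem (by simp [h])]
  · simp

lemma cnt_erase (B : Finset ℕ) (x j : ℕ) (h : x ∈ B) :
    cnt B j = cnt (B.erase x) j + if x < j then 1 else 0 := by
  conv_lhs => rw [← Finset.insert_erase h]
  exact cnt_insert _ _ _ (by simp)

lemma cnt_le_card (B : Finset ℕ) (j : ℕ) : cnt B j ≤ B.card := Finset.card_filter_le _ _

lemma cnt_eq_card (B : Finset ℕ) (j : ℕ) (h : ∀ b ∈ B, b < j) : cnt B j = B.card := by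
  unfold cnt; rw [Finset.filter_true_of_mem h]

/-- no elements of B in [i, j) -/
lemma cnt_eq_of (B : Finset ℕ) (i j : ℕ) (hij : i ≤ j) (h : ∀ b ∈ B, b < j → b < i) :
    cnt B i = cnt B j := by
  unfold cnt; congr 1; ext b; simp
  intro hb; exact ⟨fun _ => by omega, h b hb⟩

lemma cnt_pos (B : Finset ℕ) (j : ℕ) : 0 < cnt B j ↔ ∃ b ∈ B, b < j := by
  unfold cnt; rw [Finset.card_pos]; simp [Finset.Nonempty]

lemma RS_disj {w B C} (h : RS w B C) : Disjoint B C := by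
  induction h with
  | nil => simp
  | app x w B C hx hxC hm _ ih =>
    rw [Finset.disjoint_left] at ih ⊢
    intro a ha
    by_cases e : a = x
    · simpa [e] using hxC
    · exact ih (by simp [e, ha])
  | bump x y w B C hx hxC hy hyB hxy hm hm' _ ih =>
    rw [Finset.disjoint_left] at ih ⊢
    intro a ha
    by_cases e : a = x
    · simpa [e] using hxC
    · have := ih (a := a) (by simp [e, ha])
      have : a ≠ y := by rintro rfl; exact hyB ha
      simp_all

lemma RS_ballot {w B C} (h : RS w B C) : ∀ j, cnt C j ≤ cnt B j := by
  induction h with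
  | nil => intro j; simp [cnt]
  | app x w B C hx hxC hm _ ih =>
    intro j
    have := ih j
    rw [cnt_erase B x j hx]; omega
  | bump x y w B C hx hxC hy hyB hxy hm hm' _ ih =>
    intro j
    have h1 := ih j
    have h3 := ih y
    have e1 := cnt_erase B x j hx
    have e2 := cnt_erase C y j hy
    have e3 := cnt_insert (B.erase x) y j (by simp [hyB])
    have f1 := cnt_erase B x y hx
    have f3 := cnt_insert (B.erase x) y y (by simp [hyB])
    have f2 := cnt_erase C y y hy
    simp at f3 f2
    rw [if_pos hxy] at f1
    by_cases hyj : y < j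
    · have := cnt_mono (B.erase x) hyj.le
      have g1 : cnt (C.erase y) j = cnt (C.erase y) y := by
        refine (cnt_eq_of _ _ _ hyj.le ?_).symm
        intro b hb _
        simp at hb
        have := hm b hb.2
        omega
      have : x < j := by omega
      simp only [hyj, this, if_true] at *
      omega
    · simp only [hyj, if_false] at *
      omega

lemma RS_unique {w B C B' C'} (h : RS w B C) (h' : RS w B' C') : B = B' ∧ C = C' := by
  induction h generalizing B' C' with
  | nil => cases h'; simp
  | app x w B C hx hxC hm _ ih =>
    cases h' with
    | app _ _ _ _ hx' hxC' hm' h2 =>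
      obtain ⟨e1, e2⟩ := ih h2
      refine ⟨?_, e2⟩
      rw [← Finset.insert_erase hx, ← Finset.insert_erase hx', e1]
    | bump _ y _ _ _ hx' hxC' hy' hyB' hxy' hm' hm'' h2 =>
      obtain ⟨e1, e2⟩ := ih h2
      have : y ∈ B.erase x := by rw [e1]; simp
      have := hm y (Finset.mem_of_mem_erase this)
      omega
  | bump x y w B C hx hxC hy hyB hxy hm hm1 _ ih =>
    cases h' with
    | app _ _ _ _ hx' hxC' hm' h2 =>
      obtain ⟨e1, e2⟩ := ih h2
      have : y ∈ B'.erase x := by rw [← e1]; simp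
      have := hm' y (Finset.mem_of_mem_erase this)
      omega
    | bump _ z _ _ _ hx' hxC' hz hzB hxz hm' hm'' h2 =>
      obtain ⟨e1, e2⟩ := ih h2
      have hyz : y = z := by
        by_contra hne
        have a1 : y ∈ B' := by
          have : y ∈ insert z (B'.erase x) := by rw [← e1]; simp
          simp [hne] at this; exact this.2
        have a2 : z ∈ B := by
          have : z ∈ insert y (B.erase x) := by rw [e1]; simp
          simp [Ne.symm hne] at this; exact this.2
        rcases lt_or_gt_of_ne hne with h | h
        · have := hm'' y a1 h; omega
        · have := hm1 z a2 h; omega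
      subst hyz
      constructor
      · have : B.erase x = B'.erase x := by
          have := congrArg (fun s => Finset.erase s y) e1
          simpa [hyB, hzB] using this
        rw [← Finset.insert_erase hx, ← Finset.insert_erase hx', this]
      · rw [← Finset.insert_erase hy, ← Finset.insert_erase hz, e2]

/-- bump reduction -/
lemma bump_red (B C : Finset ℕ) (hd : Disjoint B C) (hb : ∀ j, cnt C j ≤ cnt B j)
    (hC : C.Nonempty) : ∃ x y, x ∈ B ∧ x ∉ C ∧ y ∈ C ∧ y ∉ B ∧ x < y ∧ (∀ c ∈ C, c ≤ y) ∧
      (∀ b ∈ B, b < y → b ≤ x) ∧ Disjoint (insert y (B.erase x)) (C.erase y) ∧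
      (∀ j, cnt (C.erase y) j ≤ cnt (insert y (B.erase x)) j) ∧
      (insert y (B.erase x)).card = B.card ∧ (C.erase y).card + 1 = C.card := by
  set y := C.max' hC with hy
  have hyC : y ∈ C := Finset.max'_mem _ _
  have hm : ∀ c ∈ C, c ≤ y := fun c hc => Finset.le_max' _ _ hc
  have hyB : y ∉ B := fun h => (Finset.disjoint_left.1 hd h) hyC
  have hpos : 0 < cnt B (y+1) := lt_of_lt_of_le ((cnt_pos _ _).2 ⟨y, hyC, by omega⟩) (hb _)
  obtain ⟨b, hbB, hby⟩ := (cnt_pos _ _).1 hpos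
  have hne : (B.filter (· < y)).Nonempty := ⟨b, by
    simp [hbB]; have : b ≠ y := by rintro rfl; exact hyB hbB
    omega⟩
  set x := (B.filter (· < y)).max' hne with hx
  have hx1 : x ∈ B.filter (· < y) := Finset.max'_mem _ _
  simp at hx1
  have hm' : ∀ b ∈ B, b < y → b ≤ x := fun b h1 h2 => Finset.le_max' _ _ (by simp [h1, h2])
  have hxC : x ∉ C := Finset.disjoint_left.1 hd hx1.1
  refine ⟨x, y, hx1.1, hxC, hyC, hyB, hx1.2, hm, hm', ?_, ?_, ?_, ?_⟩
  · rw [Finset.disjoint_left] at hd ⊢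
    intro a ha
    by_cases e : a = y
    · simp [e]
    · simp [e] at ha ⊢; exact hd ha.2
  · intro j
    have h1 := hb j
    have h3 := hb (y+1)
    have e1 := cnt_erase B x j hx1.1
    have e2 := cnt_erase C y j hyC
    have e3 := cnt_insert (B.erase x) y j (by simp [hyB])
    by_cases hyj : y < j
    · have : x < j := by omega
      simp only [hyj, this, if_true] at e1 e2 e3
      omega
    · simp only [hyj, if_false] at e1 e2 e3
      by_cases hxj : x < j
      · simp only [hxj, if_true] at e1 e2 e3
        have a1 : cnt B j = cnt B (y+1) := cnt_eq_of _ _ _ (by omega) (by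
          intro b hb h
          have : b ≠ y := by rintro rfl; exact hyB hb
          have := hm' b hb (by omega)
          omega)
        have a2 := cnt_erase C y (y+1) hyC
        simp at a2
        have a3 := cnt_mono (C.erase y) (show j ≤ y + 1 by omega)
        omega
      · simp only [hxj, if_false] at e1 e2 e3
        omega
  · rw [Finset.card_insert_of_notMem (by simp [hyB]), Finset.card_erase_add_one hx1.1]
  · exact Finset.card_erase_add_one hyC

lemma ballot_card (B C : Finset ℕ) (hb : ∀ j, cnt C j ≤ cnt B j) : C.card ≤ B.card := by
  obtain ⟨j, hj⟩ := C.bddAbove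
  have := hb (j+1)
  rw [cnt_eq_card C (j+1) (fun c hc => by have := hj hc; omega)] at this
  exact this.trans (cnt_le_card _ _)

/-- w's last step is a bump -/
def RBump (w : List ℕ) (B C : Finset ℕ) : Prop :=
  ∃ x y w', w = x :: w' ∧ x ∈ B ∧ x ∉ C ∧ y ∈ C ∧ y ∉ B ∧ x < y ∧
      (∀ c ∈ C, c ≤ y) ∧ (∀ b ∈ B, b < y → b ≤ x) ∧
      RS w' (insert y (B.erase x)) (C.erase y)

lemma bump_set (B C : Finset ℕ) (x y : ℕ) (hx : x ∈ B) (hxC : x ∉ C) (hy : y ∈ C) (hyB : y ∉ B)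
    (hxy : x < y) (hm : ∀ c ∈ C, c ≤ y) (hm' : ∀ b ∈ B, b < y → b ≤ x)
    (F : Finset (List ℕ)) (hF : ∀ w, w ∈ F ↔ RS w (insert y (B.erase x)) (C.erase y)) :
    (∀ w, w ∈ F.image (List.cons x) ↔ RBump w B C) ∧ (F.image (List.cons x)).card = F.card := by
  constructor
  · intro w
    rw [Finset.mem_image]
    constructor
    · rintro ⟨w', h, rfl⟩
      exact ⟨x, y, w', rfl, hx, hxC, hy, hyB, hxy, hm, hm', (hF _).1 h⟩
    · rintro ⟨x', y', w', rfl, hx', hxC', hy', hyB', hxy', hm1, hm1', h⟩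
      obtain rfl : y' = y := le_antisymm (hm _ hy') (hm1 _ hy)
      obtain rfl : x' = x := le_antisymm (hm' _ hx' hxy') (hm1' _ hx hxy)
      exact ⟨w', (hF _).2 h, rfl⟩
  · exact Finset.card_image_of_injective _ (List.cons_injective)

lemma count_RS (N : ℕ) : ∀ B C : Finset ℕ, B.card + C.card = N → Disjoint B C →
    (∀ j, cnt C j ≤ cnt B j) →
    ∃ F : Finset (List ℕ), (∀ w, w ∈ F ↔ RS w B C) ∧ F.card = gg B.card C.card := by
  induction N with
  | zero =>
    intro B C h _ _
    obtain rfl : B = ∅ := by rw [← Finset.card_eq_zero]; omega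
    obtain rfl : C = ∅ := by rw [← Finset.card_eq_zero]; omega
    refine ⟨{[]}, ?_, by simp [gg]⟩
    intro w
    simp
    constructor
    · rintro rfl; exact RS.nil
    · intro h
      cases h <;> simp_all
  | succ N ih =>
    intro B C h hd hb
    have hcard := ballot_card B C hb
    have hB : B.Nonempty := by rw [← Finset.card_pos]; omega
    -- app part
    have happ : ∃ F : Finset (List ℕ), (∀ w, w ∈ F ↔ ∃ x w', w = x :: w' ∧ x ∈ B ∧ x ∉ C ∧
        (∀ b ∈ B, b ≤ x) ∧ RS w' (B.erase x) C) ∧ F.card = gg (B.card - 1) C.card := by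
      set m := B.max' hB with hmdef
      have hmB : m ∈ B := Finset.max'_mem _ _
      have hm : ∀ b ∈ B, b ≤ m := fun c hc => Finset.le_max' _ _ hc
      have hmC : m ∉ C := Finset.disjoint_left.1 hd hmB
      have hce := Finset.card_erase_add_one hmB
      have key : ∀ F : Finset (List ℕ), (∀ w, w ∈ F ↔ RS w (B.erase m) C) → 
          (∀ w, w ∈ F.image (List.cons m) ↔ ∃ x w', w = x :: w' ∧ x ∈ B ∧ x ∉ C ∧
        (∀ b ∈ B, b ≤ x) ∧ RS w' (B.erase x) C) := by
        intro F hF w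
        rw [Finset.mem_image]
        constructor
        · rintro ⟨w', h, rfl⟩
          exact ⟨m, w', rfl, hmB, hmC, hm, (hF _).1 h⟩
        · rintro ⟨x', w', rfl, hx', hxC', hm1, h⟩
          obtain rfl : x' = m := le_antisymm (hm _ hx') (hm1 _ hmB)
          exact ⟨w', (hF _).2 h, rfl⟩
      by_cases hc : C.card ≤ B.card - 1
      · obtain ⟨F, hF, hFc⟩ := ih (B.erase m) C (by omega)
          (Finset.disjoint_of_subset_left (Finset.erase_subset _ _) hd) (by
            intro j
            have := cnt_erase B m j hmB
            by_cases hj : m < j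
            · have h2 : cnt B j = B.card := cnt_eq_card _ _ (fun b hb => by
                have := hm b hb; omega)
              have := cnt_le_card C j
              simp [hj] at *
              omega
            · simp [hj] at this; rw [← this]; exact hb j)
        refine ⟨F.image (List.cons m), key F hF, ?_⟩
        rw [Finset.card_image_of_injective _ (List.cons_injective), hFc]
        congr 1; omega
      · refine ⟨∅, ?_, ?_⟩
        · have : ∀ w, w ∈ (∅ : Finset (List ℕ)) ↔ RS w (B.erase m) C := by
            intro w
            simp
            intro hR
            have := ballot_card _ _ (RS_ballot hR)
            omega
          simpa using key ∅ this
        · rw [gg_lt _ _ (by omega)]; rfl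
    have hbump : ∃ F : Finset (List ℕ), (∀ w, w ∈ F ↔ RBump w B C) ∧ 
        F.card = if C.card = 0 then 0 else gg B.card (C.card - 1) := by
      by_cases hC : C.Nonempty
      · obtain ⟨x, y, hx, hxC, hy, hyB, hxy, hm, hm', hd', hb', hc1, hc2⟩ := bump_red B C hd hb hC
        obtain ⟨F, hF, hFc⟩ := ih _ _ (by omega) hd' hb'
        obtain ⟨k1, k2⟩ := bump_set B C x y hx hxC hy hyB hxy hm hm' F hF
        refine ⟨_, k1, ?_⟩
        rw [k2, hFc, if_neg (by omega), hc1]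
        congr 1; omega
      · rw [Finset.not_nonempty_iff_eq_empty] at hC
        refine ⟨∅, ?_, by simp [hC]⟩
        intro w; simp [RBump, hC]
    obtain ⟨F1, h1, c1⟩ := happ
    obtain ⟨F2, h2, c2⟩ := hbump
    refine ⟨F1 ∪ F2, ?_, ?_⟩
    · intro w
      rw [Finset.mem_union, h1, h2]
      constructor
      · rintro (⟨x, w', rfl, a, b, c, d⟩ | ⟨x, y, w', rfl, a1, a2, a3, a4, a5, a6, a7, a8⟩)
        · exact RS.app _ _ _ _ a b c d
        · exact RS.bump _ _ _ _ _ a1 a2 a3 a4 a5 a6 a7 a8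
      · intro h
        cases h with
        | nil => simp at hB
        | app x w' _ _ a b c d => exact Or.inl ⟨x, w', rfl, a, b, c, d⟩
        | bump x y w' _ _ a1 a2 a3 a4 a5 a6 a7 a8 =>
          exact Or.inr ⟨x, y, w', rfl, a1, a2, a3, a4, a5, a6, a7, a8⟩
    · rw [Finset.card_union_of_disjoint, c1, c2]
      · obtain ⟨a, ha⟩ : ∃ a, B.card = a + 1 := ⟨B.card - 1, by have := hB.card_pos; omega⟩
        rcases hc : C.card with _ | b
        · simp [gg_zero]
        · rw [ha, gg_succ _ _ (by omega)]; simp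
      · rw [Finset.disjoint_left]
        intro w w1 w2
        obtain ⟨x, w', rfl, a, b, c, d⟩ := (h1 _).1 w1
        obtain ⟨x', y, w'', e, a1, a2, a3, a4, a5, a6, a7, a8⟩ := (h2 _).1 w2
        obtain ⟨rfl, rfl⟩ := List.cons.inj e
        have := (RS_unique d a8).1
        have h3 : y ∈ B.erase x := by rw [this]; simp
        exact a4 (Finset.mem_of_mem_erase h3)

/-- count tableaux -/
lemma count_T (N : ℕ) : ∀ a b, a + b = N → ∃ F : Finset (Finset ℕ), 
    (∀ B, B ∈ F ↔ B ⊆ Finset.range (a+b) ∧ B.card = a ∧ ∀ j ≤ a + b, j ≤ 2 * cnt B j) ∧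
    F.card = gg a b := by
  induction N with
  | zero =>
    intro a b h
    obtain rfl : a = 0 := by omega
    obtain rfl : b = 0 := by omega
    refine ⟨{∅}, ?_, by simp [gg]⟩
    intro B; simp
  | succ N ih =>
    intro a b h
    by_cases hab : a < b
    · refine ⟨∅, ?_, by simp [gg_lt _ _ hab]⟩
      intro B
      simp
      intro _ h2
      refine ⟨a+b, le_rfl, ?_⟩
      have := cnt_le_card B (a+b)
      omega
    rcases b with _ | b
    · refine ⟨{Finset.range a}, ?_, by simp [gg_zero]⟩
      intro B; simp
      constructor
      · rintro rfl
        refine ⟨subset_rfl, by simp, ?_⟩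
        intro j hj
        have : cnt (Finset.range a) j = j := by
          unfold cnt
          rw [show (Finset.range a).filter (· < j) = Finset.range j by ext; simp; omega]
          simp
        omega
      · rintro ⟨h1, h2, h3⟩
        exact Finset.eq_of_subset_of_card_le h1 (by simp [h2])
    · obtain ⟨a, rfl⟩ : ∃ a', a = a' + 1 := ⟨a - 1, by omega⟩
      obtain ⟨F1, h1, c1⟩ := ih a (b+1) (by omega)
      obtain ⟨F2, h2, c2⟩ := ih (a+1) b (by omega)
      rw [show a + 1 + b = a + b + 1 by ring] at h2
      rw [show a + (b + 1) = a + b + 1 by ring] at h1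
      have hnot1 : ∀ B ∈ F1, a + b + 1 ∉ B := by
        intro B hB hm
        have := ((h1 B).1 hB).1 hm
        simp at this
      have hnot2 : ∀ B ∈ F2, a + b + 1 ∉ B := by
        intro B hB hm
        have := ((h2 B).1 hB).1 hm
        simp at this
      refine ⟨F1.image (insert (a+b+1)) ∪ F2, ?_, ?_⟩
      · intro B
        rw [Finset.mem_union, Finset.mem_image]
        rw [show a + 1 + (b+1) = a + b + 1 + 1 by ring]
        constructor
        · rintro (⟨B, hB, rfl⟩ | hB)
          · obtain ⟨q1, q2, q3⟩ := (h1 B).1 hB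
            have hcard : (insert (a+b+1) B).card = a + 1 := by
              rw [Finset.card_insert_of_notMem (hnot1 _ hB), q2]
            have hsub : insert (a+b+1) B ⊆ Finset.range (a+b+1+1) := by
              intro z hz
              rcases Finset.mem_insert.1 hz with rfl | hz
              · simp
              · have := q1 hz; simp at this ⊢; omega
            refine ⟨hsub, hcard, ?_⟩
            intro j hj
            by_cases hj' : j ≤ a + b + 1
            · have := q3 j hj'
              rw [cnt_insert _ _ _ (hnot1 _ hB)]; omega
            · rw [cnt_eq_card _ _ (fun z hz => by have := hsub hz; simp at this; omega), hcard]
              omega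
          · obtain ⟨q1, q2, q3⟩ := (h2 B).1 hB
            refine ⟨fun z hz => by have := q1 hz; simp at this ⊢; omega, q2, ?_⟩
            intro j hj
            by_cases hj' : j ≤ a + b + 1
            · exact q3 j hj'
            · rw [cnt_eq_card _ _ (fun z hz => by have := q1 hz; simp at this; omega), q2]
              omega
        · rintro ⟨q1, q2, q3⟩
          by_cases hm : a + b + 1 ∈ B
          · left
            refine ⟨B.erase (a+b+1), ?_, Finset.insert_erase hm⟩
            rw [h1]
            refine ⟨?_, ?_, ?_⟩
            · intro z hz
              simp at hz
              have := q1 hz.2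
              simp at this ⊢; omega
            · rw [Finset.card_erase_of_mem hm, q2]; rfl
            · intro j hj
              have := cnt_erase B _ j hm
              have := q3 j (by omega)
              rw [if_neg (by omega)] at *
              omega
          · right
            rw [h2]
            refine ⟨?_, q2, fun j hj => q3 j (by omega)⟩
            intro z hz
            have := q1 hz
            have : z ≠ a + b + 1 := by rintro rfl; exact hm hz
            simp at *; omega
      · rw [Finset.card_union_of_disjoint, Finset.card_image_of_injOn, c1, c2,
          gg_succ _ _ (by omega)]
        · intro B hB B' hB' e
          have := congrArg (fun s => Finset.erase s (a+b+1)) e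
          simpa [hnot1 B hB, hnot1 B' hB'] using this
        · rw [Finset.disjoint_left]
          intro B hB hB2
          obtain ⟨B', _, rfl⟩ := Finset.mem_image.1 hB
          exact hnot2 _ hB2 (by simp)

def pre (f : ℕ → ℕ) : ℕ → List ℕ
  | 0 => []
  | i + 1 => f i :: pre f i

def IncS (f : ℕ → ℕ) (i j m : ℕ) : Prop :=
  ∃ s : Finset ℕ, s.card = m ∧ StrictMonoOn f s ∧ ∀ p ∈ s, p < i ∧ f p < j

lemma IncS_succ (f : ℕ → ℕ) (i j m : ℕ) : IncS f (i+1) j m ↔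
    IncS f i j m ∨ (f i < j ∧ ∃ m', m = m' + 1 ∧ IncS f i (f i) m') := by
  constructor
  · rintro ⟨s, hs, hm, hv⟩
    by_cases hi : i ∈ s
    · right
      refine ⟨(hv i hi).2, (s.erase i).card, ?_, s.erase i, rfl, ?_, ?_⟩
      · rw [Finset.card_erase_add_one hi, hs]
      · exact hm.mono (by simp)
      · intro p hp
        simp at hp
        have := hv p hp.2
        have h2 : p < i := by omega
        exact ⟨h2, hm hp.2 hi h2⟩
    · left
      refine ⟨s, hs, hm, ?_⟩
      intro p hp
      have := hv p hp
      have h2 : p ≠ i := by rintro rfl; exact hi hp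
      exact ⟨by omega, this.2⟩
  · rintro (⟨s, hs, hm, hv⟩ | ⟨hj, m', rfl, s, hs, hm, hv⟩)
    · exact ⟨s, hs, hm, fun p hp => ⟨by have := (hv p hp).1; omega, (hv p hp).2⟩⟩
    · have hi : i ∉ s := fun h => by have := (hv i h).1; omega
      refine ⟨insert i s, by rw [Finset.card_insert_of_notMem hi, hs], ?_, ?_⟩
      · intro a ha b hb hab
        simp at ha hb
        rcases ha with rfl | ha
        · rcases hb with rfl | hb
          · omega
          · have := (hv b hb).1; omega
        · rcases hb with rfl | hb
          · exact (hv a ha).2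
          · exact hm ha hb hab
      · intro p hp
        simp at hp
        rcases hp with rfl | hp
        · exact ⟨by omega, hj⟩
        · have := hv p hp; omega

lemma RS_inc (f : ℕ → ℕ) (i : ℕ) : ∀ B C, RS (pre f i) B C → ∀ j m, IncS f i j m ↔ m ≤ cnt B j := by
  induction i with
  | zero =>
    intro B C h j m
    cases h
    simp [IncS, cnt]
    constructor
    · rintro ⟨s, rfl, _, h⟩
      rw [Finset.eq_empty_of_forall_notMem h]; rfl
    · rintro rfl
      exact ⟨∅, by simp [StrictMonoOn]⟩
  | succ i ih =>
    intro B C h j m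
    rw [IncS_succ]
    have h : RS (f i :: pre f i) B C := h
    cases h with
    | app _ _ _ _ hx hxC hm h =>
      have ih' := ih _ _ h
      simp only [ih']
      have e := cnt_erase B _ j hx
      by_cases hj : f i < j
      · have : cnt (B.erase (f i)) (f i) = cnt (B.erase (f i)) j := by
          apply cnt_eq_of _ _ _ hj.le
          intro b hb _
          simp at hb
          have := hm b hb.2
          omega
        simp only [hj, if_true, true_and] at e ⊢
        rw [this, e]
        constructor
        · rintro (h | ⟨m', rfl, h⟩) <;> omega
        · intro h
          rcases m with _ | m
          · left; omega
          · right; exact ⟨m, rfl, by omega⟩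
      · simp [hj] at e ⊢
        rw [e]
    | bump _ y _ _ _ hx hxC hy hyB hxy hm hm' h =>
      have ih' := ih _ _ h
      simp only [ih']
      have hyE : y ∉ B.erase (f i) := by simp [hyB]
      have e := cnt_erase B _ j hx
      have e1 := cnt_insert _ _ j hyE
      have e2 := cnt_insert _ _ (f i) hyE
      rw [if_neg (by omega)] at e2
      have e3 : cnt (B.erase (f i)) (f i) = cnt (B.erase (f i)) y := by
        apply cnt_eq_of _ _ _ hxy.le
        intro b hb hby
        simp at hb
        have := hm' b hb.2 hby
        omega
      rw [e, e1, e2]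
      by_cases hj : f i < j
      · have m1 := cnt_mono (B.erase (f i)) hj.le
        simp only [hj, if_true, true_and]
        by_cases hyj : y < j
        · simp only [hyj, if_true]
          constructor
          · rintro (h | ⟨m', rfl, h⟩) <;> omega
          · intro h; left; exact h
        · have m2 := cnt_mono (B.erase (f i)) (not_lt.1 hyj)
          simp only [hyj, if_false]
          constructor
          · rintro (h | ⟨m', rfl, h⟩) <;> omega
          · intro h
            rcases m with _ | m
            · left; omega
            · right; exact ⟨m, rfl, by omega⟩
      · have : ¬ y < j := by omega
        simp [hj, this]

lemma RS_mem {w B C} (h : RS w B C) : ∀ a, a ∈ w ↔ a ∈ B ∨ a ∈ C := by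
  induction h with
  | nil => simp
  | app x w B C hx hxC hm _ ih =>
    intro a
    rw [List.mem_cons, ih]
    by_cases e : a = x
    · simp [e, hx]
    · simp [e]
  | bump x y w B C hx hxC hy hyB hxy hm hm' _ ih =>
    intro a
    rw [List.mem_cons, ih]
    by_cases e : a = x
    · simp [e, hx]
    · by_cases e' : a = y
      · simp [e', hy]
      · simp [e, e']

lemma RS_length {w B C} (h : RS w B C) : w.length = B.card + C.card := by
  induction h with
  | nil => simp
  | app x w B C hx hxC hm _ ih =>
    rw [List.length_cons, ih, ← Finset.card_erase_add_one hx]; omega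
  | bump x y w B C hx hxC hy hyB hxy hm hm' _ ih =>
    rw [List.length_cons, ih, ← Finset.card_erase_add_one hx, ← Finset.card_erase_add_one hy,
      Finset.card_insert_of_notMem (by simp [hyB])]; omega

lemma mem_pre (f : ℕ → ℕ) (i a : ℕ) : a ∈ pre f i ↔ ∃ p < i, f p = a := by
  induction i with
  | zero => simp [pre]
  | succ i ih =>
    rw [pre, List.mem_cons, ih]
    constructor
    · rintro (rfl | ⟨p, hp, rfl⟩)
      · exact ⟨i, by omega, rfl⟩
      · exact ⟨p, by omega, rfl⟩
    · rintro ⟨p, hp, rfl⟩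
      by_cases e : p = i
      · left; rw [e]
      · right; exact ⟨p, by omega, rfl⟩

lemma RS_desc (f : ℕ → ℕ) (i : ℕ) : ∀ B C, RS (pre f i) B C → ∀ x,
    (∃ p q, p < q ∧ q < i ∧ x < f q ∧ f q < f p) ↔ ∃ y ∈ B, ∃ c ∈ C, x < y ∧ y < c := by
  induction i with
  | zero =>
    intro B C h x
    cases h
    simp
  | succ i ih =>
    intro B C h x
    have step : (∃ p q, p < q ∧ q < i + 1 ∧ x < f q ∧ f q < f p) ↔
        (∃ p q, p < q ∧ q < i ∧ x < f q ∧ f q < f p) ∨ (x < f i ∧ ∃ a ∈ pre f i, f i < a) := by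
      constructor
      · rintro ⟨p, q, h1, h2, h3, h4⟩
        by_cases e : q = i
        · subst e; right
          exact ⟨h3, f p, (mem_pre _ _ _).2 ⟨p, h1, rfl⟩, h4⟩
        · left; exact ⟨p, q, h1, by omega, h3, h4⟩
      · rintro (⟨p, q, h1, h2, h3, h4⟩ | ⟨h1, a, h2, h3⟩)
        · exact ⟨p, q, h1, by omega, h3, h4⟩
        · obtain ⟨p, hp, rfl⟩ := (mem_pre _ _ _).1 h2
          exact ⟨p, i, hp, by omega, h1, h3⟩
    rw [step]
    have h : RS (f i :: pre f i) B C := h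
    cases h with
    | app _ _ _ _ hx hxC hm h =>
      rw [ih _ _ h]
      have hmem := RS_mem h
      constructor
      · rintro (⟨y, hy, c, hc, h1, h2⟩ | ⟨h1, a, h2, h3⟩)
        · exact ⟨y, Finset.mem_of_mem_erase hy, c, hc, h1, h2⟩
        · rcases (hmem a).1 h2 with h4 | h4
          · have := hm a (Finset.mem_of_mem_erase h4); omega
          · exact ⟨f i, hx, a, h4, h1, h3⟩
      · rintro ⟨y, hy, c, hc, h1, h2⟩
        by_cases e : y = f i
        · subst e; right; exact ⟨h1, c, (hmem c).2 (Or.inr hc), h2⟩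
        · left; exact ⟨y, by simp [e, hy], c, hc, h1, h2⟩
    | bump _ y _ _ _ hx hxC hy hyB hxy hm hm' h =>
      rw [ih _ _ h]
      have hmem := RS_mem h
      have r : (∃ y ∈ B, ∃ c ∈ C, x < y ∧ y < c) ↔ x < f i := by
        constructor
        · rintro ⟨b, hb, c, hc, h1, h2⟩
          have := hm c hc
          have := hm' b hb (by omega)
          omega
        · intro h; exact ⟨f i, hx, y, hy, h, hxy⟩
      rw [r]
      constructor
      · rintro (⟨b, hb, c, hc, h1, h2⟩ | ⟨h1, _⟩)
        · have := hm c (Finset.mem_of_mem_erase hc)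
          have hne : b ≠ y := by omega
          simp [hne] at hb
          have := hm' b hb.2 (by omega)
          omega
        · exact h1
      · intro h
        exact Or.inr ⟨h, y, (hmem y).2 (by simp), hxy⟩

lemma RS_exists (f : ℕ → ℕ) (i : ℕ) : (∀ p q, p < i → q < i → f p = f q → p = q) →
    (∀ p q r, p < q → q < r → r < i → f r < f q → f q < f p → False) →
    ∃ B C, RS (pre f i) B C := by
  induction i with
  | zero => intro _ _; exact ⟨∅, ∅, RS.nil⟩
  | succ i ih =>
    intro hinj hav
    obtain ⟨B, C, h⟩ := ih (fun p q hp hq => hinj p q (by omega) (by omega))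
      (fun p q r h1 h2 h3 => hav p q r h1 h2 (by omega))
    have hnot : f i ∉ pre f i := by
      rw [mem_pre]
      rintro ⟨p, hp, e⟩
      have := hinj p i (by omega) (by omega) e
      omega
    rw [RS_mem h, not_or] at hnot
    obtain ⟨hB, hC⟩ := hnot
    have hd := RS_disj h
    rw [pre]
    by_cases hall : ∀ b ∈ B, b < f i
    · refine ⟨insert (f i) B, C, RS.app _ _ _ _ (by simp) hC ?_ ?_⟩
      · intro b hb
        rcases Finset.mem_insert.1 hb with rfl | hb
        · exact le_rfl
        · exact (hall b hb).le
      · rw [Finset.erase_insert hB]; exact h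
    · push Not at hall
      obtain ⟨b, hb, hbi⟩ := hall
      have hne : (B.filter (f i < ·)).Nonempty := ⟨b, by
        simp [hb]; have : b ≠ f i := by rintro rfl; exact hB hb
        omega⟩
      obtain ⟨y, hy, hym⟩ : ∃ y ∈ B.filter (f i < ·), ∀ z ∈ B.filter (f i < ·), y ≤ z :=
        ⟨_, Finset.min'_mem _ hne, fun z hz => Finset.min'_le _ _ hz⟩
      simp at hy hym
      have hyC : y ∉ C := Finset.disjoint_left.1 hd hy.1
      refine ⟨insert (f i) (B.erase y), insert y C, RS.bump _ y _ _ _ (by simp) ?_ (by simp) ?_ hy.2 ?_ ?_ ?_⟩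
      · simp [hC]; omega
      · simp; omega
      · intro c hc
        rcases Finset.mem_insert.1 hc with rfl | hc
        · exact le_rfl
        · by_contra hlt
          obtain ⟨p, q, h1, h2, h3, h4⟩ := (RS_desc f i B C h (f i)).2 ⟨y, hy.1, c, hc, hy.2, by omega⟩
          exact hav p q i h1 h2 (by omega) h3 h4
      · intro b hb hby
        rcases Finset.mem_insert.1 hb with rfl | hb
        · exact le_rfl
        · by_contra hlt
          have := hym b (Finset.mem_of_mem_erase hb) (by omega)
          omega
      · rw [Finset.erase_insert (by simp [hB]), Finset.insert_erase hy.1, Finset.erase_insert hyC]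
        exact h

lemma RS_avoid (f : ℕ → ℕ) (i : ℕ) : ∀ B C, RS (pre f i) B C →
    (∀ p q r, p < q → q < r → r < i → f r < f q → f q < f p → False) := by
  induction i with
  | zero => intro _ _ _ p q r _ _ h; omega
  | succ i ih =>
    intro B C h p q r h1 h2 h3 h4 h5
    have h : RS (f i :: pre f i) B C := h
    have key : ∀ B0 C0, RS (pre f i) B0 C0 → ∃ y ∈ B0, ∃ c ∈ C0, f i < y ∧ y < c := by
      intro B0 C0 h0
      by_cases e : r = i
      · subst e
        exact (RS_desc f r B0 C0 h0 (f r)).1 ⟨p, q, h1, h2, h4, h5⟩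
      · exact (ih _ _ h0 p q r h1 h2 (by omega) h4 h5).elim
    cases h with
    | app _ _ _ _ hx hxC hm h =>
      obtain ⟨y, hy, c, hc, g1, g2⟩ := key _ _ h
      have := hm y (Finset.mem_of_mem_erase hy)
      omega
    | bump _ y _ _ _ hx hxC hy hyB hxy hm hm' h =>
      obtain ⟨b, hb, c, hc, g1, g2⟩ := key _ _ h
      have := hm c (Finset.mem_of_mem_erase hc)
      have hne : b ≠ y := by omega
      simp [hne] at hb
      have := hm' b hb.2 (by omega)
      omega

lemma pre_inj (f g : ℕ → ℕ) (n : ℕ) (h : pre f n = pre g n) : ∀ i < n, f i = g i := by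
  induction n with
  | zero => intro i hi; omega
  | succ n ih =>
    obtain ⟨h1, h2⟩ := List.cons.inj h
    intro i hi
    by_cases e : i = n
    · rw [e, h1]
    · exact ih h2 i (by omega)

lemma pre_congr (f g : ℕ → ℕ) (n : ℕ) (h : ∀ i < n, f i = g i) : pre f n = pre g n := by
  induction n with
  | zero => rfl
  | succ n ih => rw [pre, pre, h n (by omega), ih (fun i hi => h i (by omega))]

lemma pre_surj (w : List ℕ) : ∃ f, pre f w.length = w := by
  induction w with
  | nil => exact ⟨id, rfl⟩
  | cons x w ih =>
    obtain ⟨f, hf⟩ := ih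
    refine ⟨fun i => if i < w.length then f i else x, ?_⟩
    rw [List.length_cons, pre]
    congr 1
    · simp
    · conv_rhs => rw [← hf]
      exact pre_congr _ _ _ (fun i hi => by simp [hi])

def extF {n : ℕ} (σ : Fin n → Fin n) (i : ℕ) : ℕ := if h : i < n then (σ ⟨i, h⟩).val else 0

lemma extF_val {n : ℕ} (σ : Fin n → Fin n) (i : Fin n) : extF σ i.val = (σ i).val := by
  simp [extF]

lemma extF_inc {n : ℕ} (σ : Fin n → Fin n) (i j m : ℕ) (hi : i ≤ n) :
    (∃ s : Finset (Fin n), s.card = m ∧ StrictMonoOn σ s ∧ ∀ p ∈ s, p.val < i ∧ (σ p).val < j) ↔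
      IncS (extF σ) i j m := by
  constructor
  · rintro ⟨s, hs, hm, hv⟩
    refine ⟨s.image Fin.val, ?_, ?_, ?_⟩
    · rw [Finset.card_image_of_injective _ Fin.val_injective, hs]
    · intro a ha b hb hab
      simp only [Finset.coe_image, Set.mem_image, Finset.mem_coe] at ha hb
      obtain ⟨a, ha, rfl⟩ := ha
      obtain ⟨b, hb, rfl⟩ := hb
      rw [extF_val, extF_val]
      exact hm ha hb hab
    · intro p hp
      rw [Finset.mem_image] at hp
      obtain ⟨a, ha, rfl⟩ := hp
      rw [extF_val]
      exact hv a ha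
  · rintro ⟨s, hs, hm, hv⟩
    set t : Finset (Fin n) := Finset.univ.filter (fun p => p.val ∈ s) with ht
    have himg : t.image Fin.val = s := by
      ext x
      simp [ht]
      constructor
      · rintro ⟨a, ha, rfl⟩; exact ha
      · intro hx
        have := (hv x hx).1
        exact ⟨⟨x, by omega⟩, hx, rfl⟩
    refine ⟨t, ?_, ?_, ?_⟩
    · rw [← hs, ← himg, Finset.card_image_of_injective _ Fin.val_injective]
    · intro a ha b hb hab
      simp [ht] at ha hb
      have := hm ha hb hab
      rw [extF_val, extF_val] at this
      exact this
    · intro p hp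
      simp [ht] at hp
      have := hv _ hp
      rwa [extF_val] at this

lemma extF_dec {n : ℕ} (σ : Fin n → Fin n) : ¬ HasDecr 3 n σ ↔
    (∀ p q r, p < q → q < r → r < n → extF σ r < extF σ q → extF σ q < extF σ p → False) := by
  rw [hasDecr_iff]
  constructor
  · intro h p q r h1 h2 h3 h4 h5
    apply h
    refine ⟨⟨p, by omega⟩, ⟨q, by omega⟩, ⟨r, h3⟩, h1, h2, ?_, ?_⟩
    · simpa [extF, h3, h2.trans h3] using h4
    · simpa [extF, h2.trans h3, h1.trans (h2.trans h3)] using h5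
  · rintro h ⟨a, b, c, h1, h2, h3, h4⟩
    exact h a b c h1 h2 c.isLt (by rw [extF_val, extF_val]; exact h3)
      (by rw [extF_val, extF_val]; exact h4)

/-- the final list description -/
lemma trc_iff_list {k n : ℕ} (hk : 1 ≤ k) (hn : 1 ≤ n) (σ : Equiv.Perm (Fin n)) :
    TopRightCrucial k 3 n σ ↔ ∃ B, B ⊆ Finset.range (n - 1) ∧ B.card = k - 1 ∧ 
      RBump (pre (extF σ) n) B (Finset.range n \ B) := by
  set f := extF σ with hf
  have t1 : HasIncr k n σ ↔ IncS f n n k := by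
    rw [hasIncr_iff, ← extF_inc σ n n k le_rfl]
    simp
  have t2 : (∃ s : Finset (Fin n), s.card = k - 1 ∧ StrictMonoOn σ s ∧ ∀ p ∈ s, (σ p).val < n - 1) ↔
      IncS f n (n-1) (k-1) := by
    rw [← extF_inc σ n (n-1) (k-1) le_rfl]
    simp
  have t3 : (∃ s : Finset (Fin n), s.card = k - 1 ∧ StrictMonoOn σ s ∧ ∀ p ∈ s, p.val < n - 1) ↔
      IncS f (n-1) n (k-1) := by
    rw [← extF_inc σ (n-1) n (k-1) (by omega)]
    simp
  rw [trc_iff hk hn, t1, t2, t3, extF_dec]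
  have hlt : ∀ p < n, f p < n := fun p hp => by simp [hf, extF, hp]
  obtain ⟨n, rfl⟩ : ∃ n', n = n' + 1 := ⟨n - 1, by omega⟩
  simp only [Nat.add_sub_cancel]
  constructor
  · rintro ⟨h1, h2, h3, h4⟩
    obtain ⟨B, C, h⟩ := RS_exists f (n+1) (by
      intro p q hp hq e
      have e1 : f p = (σ ⟨p, hp⟩).val := by simp [hf, extF, hp]
      have e2 : f q = (σ ⟨q, hq⟩).val := by simp [hf, extF, hq]
      rw [e1, e2] at e
      have := σ.injective (Fin.val_injective e)
      simpa using this) h2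
    have hmem : ∀ a, a ∈ B ∨ a ∈ C ↔ a < n + 1 := by
      intro a
      rw [← RS_mem h, mem_pre]
      constructor
      · rintro ⟨p, hp, rfl⟩; exact hlt p hp
      · intro ha
        refine ⟨(σ.symm ⟨a, ha⟩).val, (σ.symm ⟨a, ha⟩).isLt, ?_⟩
        rw [hf, extF_val]; simp
    have hd := RS_disj h
    have hC : C = Finset.range (n+1) \ B := by
      ext a
      have := hmem a
      have h2 : a ∈ B → a ∉ C := fun h => Finset.disjoint_left.1 hd h
      simp only [Finset.mem_sdiff, Finset.mem_range]
      tauto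
    rw [RS_inc f _ _ _ h] at h1 h3
    rw [cnt_eq_card B _ (fun b hb => (hmem b).1 (Or.inl hb))] at h1
    have hcc := cnt_le_card B n
    have hBc : B.card = k - 1 := by omega
    have hBs : B ⊆ Finset.range n := by
      intro b hb
      have hb1 := (hmem b).1 (Or.inl hb)
      rw [Finset.mem_range]
      by_contra hbn
      obtain rfl : b = n := by omega
      have := cnt_erase B b b hb
      simp at this
      have := cnt_le_card (B.erase b) b
      have := Finset.card_erase_add_one hb
      omega
    refine ⟨B, hBs, hBc, ?_⟩
    have h' : RS (f n :: pre f n) B C := h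
    cases h' with
    | app _ _ _ _ hx hxC hm h =>
      rw [RS_inc f _ _ _ h] at h4
      have := cnt_le_card (B.erase (f n)) (n+1)
      have := Finset.card_erase_add_one hx
      omega
    | bump _ y _ _ _ hx hxC hy hyB hxy hm hm' h =>
      rw [← hC]
      exact ⟨f n, y, pre f n, rfl, hx, hxC, hy, hyB, hxy, hm, hm', h⟩
  · rintro ⟨B, hBs, hBc, x, y, w', e, hx, hxC, hy, hyB, hxy, hm, hm', h⟩
    obtain ⟨rfl, rfl⟩ := List.cons.inj e
    have h0 : RS (pre f (n+1)) B (Finset.range (n+1) \ B) :=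
      RS.bump _ y _ _ _ hx hxC hy hyB hxy hm hm' h
    have hb : ∀ b ∈ B, b < n := fun b hb => Finset.mem_range.1 (hBs hb)
    refine ⟨?_, RS_avoid f _ _ _ h0, ?_, ?_⟩
    · rw [RS_inc f _ _ _ h0]
      have := cnt_le_card B (n+1)
      omega
    · rw [RS_inc f _ _ _ h0, cnt_eq_card _ _ hb, hBc]
    · rw [RS_inc f _ _ _ h, cnt_eq_card, Finset.card_insert_of_notMem (by simp [hyB]),
        Finset.card_erase_add_one hx, hBc]
      intro b hb'
      rcases Finset.mem_insert.1 hb' with rfl | hb'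
      · simp at hy; omega
      · have := hb b (Finset.mem_of_mem_erase hb'); omega

lemma cnt_compl (n : ℕ) (B : Finset ℕ) (hB : B ⊆ Finset.range n) (j : ℕ) (hj : j ≤ n) :
    cnt B j + cnt (Finset.range n \ B) j = j := by
  unfold cnt
  rw [← Finset.card_union_of_disjoint]
  · rw [← Finset.filter_union, Finset.union_sdiff_of_subset hB,
      show (Finset.range n).filter (· < j) = Finset.range j by ext; simp; omega]
    simp
  · exact Finset.disjoint_filter_filter Finset.disjoint_sdiff

lemma RBump_RS {w B C} (h : RBump w B C) : RS w B C := by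
  obtain ⟨x, y, w', rfl, a1, a2, a3, a4, a5, a6, a7, a8⟩ := h
  exact RS.bump _ _ _ _ _ a1 a2 a3 a4 a5 a6 a7 a8

lemma count_G (k n : ℕ) (hk : 3 ≤ k) (h1 : k + 1 ≤ n) (h2 : n ≤ 2 * (k - 1)) :
    ∃ G : Finset (List ℕ), (∀ w, w ∈ G ↔ ∃ B, B ⊆ Finset.range (n - 1) ∧ B.card = k - 1 ∧ 
      RBump w B (Finset.range n \ B)) ∧ G.card = gg (k-1) (n-k) * gg (k-1) (n-k) := by
  obtain ⟨T, hT, hTc⟩ := count_T _ (k-1) (n-k) rfl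
  rw [show k - 1 + (n - k) = n - 1 by omega] at hT
  have hsub : ∀ B : Finset ℕ, B ⊆ Finset.range (n-1) → B ⊆ Finset.range n := fun B hB z hz => by
    have := hB hz; simp at this ⊢; omega
  have hcardC : ∀ B : Finset ℕ, B ⊆ Finset.range (n-1) → B.card = k - 1 →
      (Finset.range n \ B).card = n - k + 1 := by
    intro B hB hc
    rw [Finset.card_sdiff_of_subset (hsub B hB), hc]; simp; omega
  have hex : ∀ B : Finset ℕ, ∃ F : Finset (List ℕ), B ∈ T →
      (∀ w, w ∈ F ↔ RBump w B (Finset.range n \ B)) ∧ F.card = gg (k-1) (n-k) := by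
    intro B
    by_cases hB : B ∈ T
    · obtain ⟨q1, q2, q3⟩ := (hT B).1 hB
      have hC := hcardC B q1 q2
      have hbal : ∀ j, cnt (Finset.range n \ B) j ≤ cnt B j := by
        intro j
        by_cases hj : j ≤ n - 1
        · have := cnt_compl n B (hsub B q1) j (by omega)
          have := q3 j hj
          omega
        · rw [cnt_eq_card B _ (fun z hz => by have := q1 hz; simp at this; omega)]
          have := cnt_le_card (Finset.range n \ B) j
          omega
      obtain ⟨x, y, hx, hxC, hy, hyB, hxy, hm, hm', hd', hb', hc1, hc2⟩ :=
        bump_red B (Finset.range n \ B) Finset.disjoint_sdiff hbal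
          (by rw [← Finset.card_pos]; omega)
      obtain ⟨F, hF, hFc⟩ := count_RS _ _ _ rfl hd' hb'
      obtain ⟨k1, k2⟩ := bump_set _ _ x y hx hxC hy hyB hxy hm hm' F hF
      refine ⟨_, fun _ => ⟨k1, ?_⟩⟩
      rw [k2, hFc, hc1, q2]
      congr 1; omega
    · exact ⟨∅, fun h => absurd h hB⟩
  choose F hF using hex
  refine ⟨T.biUnion F, ?_, ?_⟩
  · intro w
    rw [Finset.mem_biUnion]
    constructor
    · rintro ⟨B, hB, hw⟩
      obtain ⟨q1, q2, q3⟩ := (hT B).1 hB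
      exact ⟨B, q1, q2, ((hF B hB).1 w).1 hw⟩
    · rintro ⟨B, q1, q2, hw⟩
      have hB : B ∈ T := by
        refine (hT B).2 ⟨q1, q2, ?_⟩
        intro j hj
        have := cnt_compl n B (hsub B q1) j (by omega)
        have := RS_ballot (RBump_RS hw) j
        omega
      exact ⟨B, hB, ((hF B hB).1 w).2 hw⟩
  · rw [Finset.card_biUnion, Finset.sum_congr rfl (fun B hB => (hF B hB).2), Finset.sum_const, hTc]
    · simp
    · intro B hB B' hB' hne
      refine Finset.disjoint_left.2 ?_
      intro w hw hw'
      exact hne (RS_unique (RBump_RS (((hF B hB).1 w).1 hw)) (RBump_RS (((hF B' hB').1 w).1 hw'))).1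

theorem count_k3_topRightCrucial (k : ℕ) (hk : 3 ≤ k)
    (n : ℕ) (h1 : k + 1 ≤ n) (h2 : n ≤ 2 * (k - 1)) :
    Nat.card {σ : Equiv.Perm (Fin n) // TopRightCrucial k 3 n ⇑σ} * (n - k) ^ 2 =
      ((2 * k - n) * Nat.choose (n - 1) k) ^ 2 := by
  obtain ⟨G, hG, hGc⟩ := count_G k n hk h1 h2
  have hiff := fun σ : Equiv.Perm (Fin n) => trc_iff_list (k := k) (by omega) (by omega) σ
  have hcard : Nat.card {σ : Equiv.Perm (Fin n) // TopRightCrucial k 3 n ⇑σ} = G.card := by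
    have hGG : Nat.card (G : Set (List ℕ)) = G.card := by simp
    rw [← hGG]
    refine Nat.card_eq_of_bijective
      (fun σ => (⟨pre (extF σ.1) n, by
        rw [Finset.mem_coe, hG]; exact (hiff σ.1).1 σ.2⟩ : (G : Set (List ℕ)))) ⟨?_, ?_⟩
    · rintro ⟨σ, hσ⟩ ⟨τ, hτ⟩ e
      have e' : pre (extF σ) n = pre (extF τ) n := congrArg Subtype.val e
      have := pre_inj _ _ _ e'
      apply Subtype.ext
      ext i
      have := this i.val i.isLt
      rw [extF_val, extF_val] at this
      exact this
    · rintro ⟨w, hw⟩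
      rw [Finset.mem_coe, hG] at hw
      obtain ⟨B, hBs, hBc, hw⟩ := hw
      have hR := RBump_RS hw
      have hBn : B ⊆ Finset.range n := fun z hz => by
        have := hBs hz; simp at this ⊢; omega
      have hlen : w.length = n := by
        rw [RS_length hR, Finset.card_sdiff_of_subset hBn]
        simp; omega
      obtain ⟨f, hf⟩ := pre_surj w
      rw [hlen] at hf
      have hmem : ∀ a, a ∈ w ↔ a < n := by
        intro a
        rw [RS_mem hR]
        have := @hBn a
        simp at this ⊢
        tauto
      have hlt : ∀ i : Fin n, f i.val < n := fun i => by
        rw [← hmem, ← hf, mem_pre]; exact ⟨i, i.isLt, rfl⟩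
      have hsurj : Function.Surjective (fun i : Fin n => (⟨f i.val, hlt i⟩ : Fin n)) := by
        intro a
        have := (hmem a.val).2 a.isLt
        rw [← hf, mem_pre] at this
        obtain ⟨p, hp, e⟩ := this
        exact ⟨⟨p, hp⟩, Fin.ext e⟩
      let σ : Equiv.Perm (Fin n) := Equiv.ofBijective _ (Finite.injective_iff_bijective.1
        (Finite.injective_iff_surjective.2 hsurj))
      have hσ : pre (extF σ) n = w := by
        rw [← hf]
        apply pre_congr
        intro i hi
        simp [extF, hi, σ]
      refine ⟨⟨σ, (hiff σ).2 ⟨B, hBs, hBc, by rw [hσ]; exact hw⟩⟩, Subtype.ext hσ⟩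
  rw [hcard, hGc, ← gg_final k n h1 h2]
  ring
end
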